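/- (Quenched fluctuations of 𝓛) Let M_u, M_v > 0. For n large enough, there exists a constant M such that for all (a,b) ∈ (0,M_u)² with a < min{1,b}, all δ ∈ (0,a), all R_v ∈ [0,M_v] and all t ∈ [0,1]: ∫_a^b E[ ( ⟨𝓛⟩_{t,(R_u,R_v)} − E⟨𝓛⟩_{t,(R_u,R_v)} )² ] dR_u ≤ M ( 1/(δ² n) − ln(a)/n + δ/(a−δ) ). -/

import Mathlib

open MeasureTheory Real Filter Set

noncomputable section

/-- i.i.d. standard Gaussian measure on `Fin n → ℝ`. -/
def stdGaussian (n : ℕ) : Measure (Fin n → ℝ) :=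
  Measure.pi fun _ : Fin n => ProbabilityTheory.gaussianReal 0 1

/-- i.i.d. standard Gaussian measure on matrices `Fin p → Fin q → ℝ`. -/
def stdGaussianMat (p q : ℕ) : Measure (Fin p → Fin q → ℝ) :=
  Measure.pi fun _ : Fin p => stdGaussian q

/-- `P` is the uniform (rotation-invariant) probability measure on the sphere of
radius `r` centered at the origin in `ℝⁿ`. -/
def IsUniformSphere (n : ℕ) (r : ℝ) (P : Measure (Fin n → ℝ)) : Prop :=
  IsProbabilityMeasure P ∧
  (∀ᵐ x ∂P, ∑ i, (x i) ^ 2 = r ^ 2) ∧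
  ∀ O : Matrix (Fin n) (Fin n) ℝ, O ∈ Matrix.orthogonalGroup (Fin n) ℝ →
    P.map (fun x => O.mulVec x) = P

/-- The interpolating Hamiltonian `H_{t,R}(u,v)`, with the observations
`Y^{(t)} = √((1−t)/n) U Vᵀ + Z`, `Ỹ = √(α_v R_v) U + Z̃`, `Ȳ = √(α_u R_u) V + Z̄`
substituted. -/
def interpH (n nu nv : ℕ) (au av t Ru Rv : ℝ)
    (U : Fin nu → ℝ) (V : Fin nv → ℝ) (Z : Fin nu → Fin nv → ℝ)
    (Zt : Fin nu → ℝ) (Zb : Fin nv → ℝ)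
    (u : Fin nu → ℝ) (v : Fin nv → ℝ) : ℝ :=
  (∑ i, ∑ j, ((1 - t) / (2 * n) * (u i) ^ 2 * (v j) ^ 2
      - Real.sqrt ((1 - t) / n) * u i * v j
          * (Real.sqrt ((1 - t) / n) * U i * V j + Z i j)))
  + (∑ i, (av * Rv / 2 * (u i) ^ 2
      - Real.sqrt (av * Rv) * u i * (Real.sqrt (av * Rv) * U i + Zt i)))
  + (∑ j, (au * Ru / 2 * (v j) ^ 2
      - Real.sqrt (au * Ru) * v j * (Real.sqrt (au * Ru) * V j + Zb j)))

/-- The partition function `Z_{t,R} = ∫∫ e^{−H_{t,R}(u,v)} dP_u(u) dP_v(v)`. -/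
def partFun (n nu nv : ℕ) (au av t Ru Rv : ℝ)
    (Pu : Measure (Fin nu → ℝ)) (Pv : Measure (Fin nv → ℝ))
    (U : Fin nu → ℝ) (V : Fin nv → ℝ) (Z : Fin nu → Fin nv → ℝ)
    (Zt : Fin nu → ℝ) (Zb : Fin nv → ℝ) : ℝ :=
  ∫ u, (∫ v, Real.exp (-(interpH n nu nv au av t Ru Rv U V Z Zt Zb u v)) ∂Pv) ∂Pu

/-- The Gibbs bracket `⟨f⟩_{t,R}`, i.e. the expectation of `f(u,v)` under the
posterior measure proportional to `e^{−H_{t,R}(u,v)} dP_u(u) dP_v(v)`. -/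
def gibbs (n nu nv : ℕ) (au av t Ru Rv : ℝ)
    (Pu : Measure (Fin nu → ℝ)) (Pv : Measure (Fin nv → ℝ))
    (U : Fin nu → ℝ) (V : Fin nv → ℝ) (Z : Fin nu → Fin nv → ℝ)
    (Zt : Fin nu → ℝ) (Zb : Fin nv → ℝ)
    (f : (Fin nu → ℝ) → (Fin nv → ℝ) → ℝ) : ℝ :=
  (∫ u, (∫ v, f u v * Real.exp (-(interpH n nu nv au av t Ru Rv U V Z Zt Zb u v)) ∂Pv) ∂Pu)
    / partFun n nu nv au av t Ru Rv Pu Pv U V Z Zt Zb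

/-- Expectation `E` over all the randomness `U ~ P_u`, `V ~ P_v` and the independent
standard Gaussian noises `Z, Z̃, Z̄`. -/
def Efull (nu nv : ℕ)
    (Pu : Measure (Fin nu → ℝ)) (Pv : Measure (Fin nv → ℝ))
    (g : (Fin nu → ℝ) → (Fin nv → ℝ) → (Fin nu → Fin nv → ℝ) →
      (Fin nu → ℝ) → (Fin nv → ℝ) → ℝ) : ℝ :=
  ∫ U, (∫ V, (∫ Z, (∫ Zt, (∫ Zb, g U V Z Zt Zb
    ∂(stdGaussian nv)) ∂(stdGaussian nu)) ∂(stdGaussianMat nu nv)) ∂Pv) ∂Pu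

/-- The average interpolating free entropy `fₙ(t,R) = (1/n) E ln Z_{t,R}`. -/
def interpFreeEntropy (n nu nv : ℕ) (au av t Ru Rv : ℝ)
    (Pu : Measure (Fin nu → ℝ)) (Pv : Measure (Fin nv → ℝ)) : ℝ :=
  (1 / (n : ℝ)) * Efull nu nv Pu Pv (fun U V Z Zt Zb =>
    Real.log (partFun n nu nv au av t Ru Rv Pu Pv U V Z Zt Zb))

/-- The overlap `Q_u = (1/n_u) Σ_i u_i U_i`. -/
def overlapU (nu : ℕ) (u U : Fin nu → ℝ) : ℝ := (1 / (nu : ℝ)) * ∑ i, u i * U i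

/-- The overlap `Q_v = (1/n_v) Σ_j v_j V_j`. -/
def overlapV (nv : ℕ) (v V : Fin nv → ℝ) : ℝ := (1 / (nv : ℝ)) * ∑ j, v j * V j

/-- `E⟨Q_v⟩_{t,R}`. -/
def eQv (n nu nv : ℕ) (au av t Ru Rv : ℝ)
    (Pu : Measure (Fin nu → ℝ)) (Pv : Measure (Fin nv → ℝ)) : ℝ :=
  Efull nu nv Pu Pv (fun U V Z Zt Zb =>
    gibbs n nu nv au av t Ru Rv Pu Pv U V Z Zt Zb (fun _ v => overlapV nv v V))

/-- `E⟨Q_u⟩_{t,R}`. -/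
def eQu (n nu nv : ℕ) (au av t Ru Rv : ℝ)
    (Pu : Measure (Fin nu → ℝ)) (Pv : Measure (Fin nv → ℝ)) : ℝ :=
  Efull nu nv Pu Pv (fun U V Z Zt Zb =>
    gibbs n nu nv au av t Ru Rv Pu Pv U V Z Zt Zb (fun u _ => overlapU nu u U))

/-- The quantity `𝓛 = (1/n) Σ_j [(α_u/2)v_j² − α_u v_j V_j − (1/2)√(α_u/R_u) v_j Z̄_j]`. -/
def calL (n nv : ℕ) (au Ru : ℝ) (v V Zb : Fin nv → ℝ) : ℝ :=
  (1 / (n : ℝ)) * ∑ j, (au / 2 * (v j) ^ 2 - au * v j * V j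
    - 1 / 2 * Real.sqrt (au / Ru) * v j * Zb j)

/-- `E⟨𝓛⟩_{t,R}`. -/
def eL (n nu nv : ℕ) (au av t Ru Rv : ℝ)
    (Pu : Measure (Fin nu → ℝ)) (Pv : Measure (Fin nv → ℝ)) : ℝ :=
  Efull nu nv Pu Pv (fun U V Z Zt Zb =>
    gibbs n nu nv au av t Ru Rv Pu Pv U V Z Zt Zb (fun _ v => calL n nv au Ru v V Zb))

/-- `φ₀(m) = (m − ln(1+m))/2`. -/
def phi0 (m : ℝ) : ℝ := (m - Real.log (1 + m)) / 2


/-- The quenched variance of the Gibbs mean of `𝓛` : `E[(⟨𝓛⟩ − E⟨𝓛⟩)²]`. -/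
def quenchedVarL (n nu nv : ℕ) (au av t Ru Rv : ℝ)
    (Pu : Measure (Fin nu → ℝ)) (Pv : Measure (Fin nv → ℝ)) : ℝ :=
  Efull nu nv Pu Pv (fun U V Z Zt Zb =>
    (gibbs n nu nv au av t Ru Rv Pu Pv U V Z Zt Zb (fun _ v => calL n nv au Ru v V Zb)
      - eL n nu nv au av t Ru Rv Pu Pv) ^ 2)

open scoped RealInnerProductSpace

section GaussianVariance

variable {E : Type*} [NormedAddCommGroup E] [InnerProductSpace ℝ E] [FiniteDimensional ℝ E]
  [MeasurableSpace E] [BorelSpace E]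

lemma integral_inner_sq_stdGaussian (a : E) :
    ∫ y, ⟪a, y⟫ ^ 2 ∂(ProbabilityTheory.stdGaussian E) = ‖a‖ ^ 2 := by
  have h := ProbabilityTheory.variance_dual_stdGaussian (innerSL ℝ a)
  rw [ProbabilityTheory.variance_of_integral_eq_zero
    (innerSL ℝ a).continuous.aemeasurable
    (ProbabilityTheory.integral_strongDual_stdGaussian _)] at h
  simpa using h

lemma measurePreserving_rotation_stdGaussian (θ : ℝ) :
    MeasurePreserving (ContinuousLinearMap.rotation (E := E) θ)
      ((ProbabilityTheory.stdGaussian E).prod (ProbabilityTheory.stdGaussian E))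
      ((ProbabilityTheory.stdGaussian E).prod (ProbabilityTheory.stdGaussian E)) :=
  ⟨(ContinuousLinearMap.rotation θ).continuous.measurable,
    ProbabilityTheory.IsGaussian.map_rotation_eq_self
      (ProbabilityTheory.integral_id_stdGaussian) θ⟩

lemma memLp_of_subgradient {f : E → ℝ} {p : E → E} (hf : Measurable f)
    {L : ℝ} (hL : ∀ x, ‖p x‖ ≤ L) (hsub : ∀ x y, f x + ⟪p x, y - x⟫ ≤ f y) :
    MemLp f 2 (ProbabilityTheory.stdGaussian E) := by
  have hid : MemLp (fun x : E => ‖x‖) 2 (ProbabilityTheory.stdGaussian E) :=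
    ProbabilityTheory.IsGaussian.memLp_two_id.norm
  have hg : MemLp (fun x : E => |f 0| + L * ‖x‖) 2 (ProbabilityTheory.stdGaussian E) :=
    (memLp_const |f 0|).add (hid.const_mul L)
  refine hg.mono hf.aestronglyMeasurable (Eventually.of_forall fun x => ?_)
  have hb : ∀ a b : E, |⟪p a, b⟫| ≤ L * ‖b‖ := fun a b =>
    (abs_real_inner_le_norm _ _).trans (mul_le_mul_of_nonneg_right (hL a) (norm_nonneg _))
  have h1 := hsub 0 x
  have h2 := hsub x 0
  have h3 := abs_le.1 (hb 0 x)
  have h4 := abs_le.1 (hb x x)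
  simp only [sub_zero, zero_sub, inner_neg_right] at h1 h2
  have h5 := neg_abs_le (f 0)
  have h6 := le_abs_self (f 0)
  rw [Real.norm_eq_abs, Real.norm_eq_abs]
  refine le_trans (abs_le.2 ⟨?_, ?_⟩) (le_abs_self _) <;> linarith

lemma integral_sub_sq_rotation_le {f : E → ℝ} {p : E → E} (hp : Measurable p)
    {L : ℝ} (hL : ∀ x, ‖p x‖ ≤ L) (hsub : ∀ x y, f x + ⟪p x, y - x⟫ ≤ f y) (ε : ℝ) :
    ∫ z : E × E, (f z.1 - f (cos ε • z.1 + sin ε • z.2)) ^ 2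
      ∂((ProbabilityTheory.stdGaussian E).prod (ProbabilityTheory.stdGaussian E)) ≤
    4 * (1 - cos ε) ^ 2 * L ^ 2 * (∫ x, ‖x‖ ^ 2 ∂(ProbabilityTheory.stdGaussian E))
      + 4 * sin ε ^ 2 * L ^ 2 := by
  set μ := ProbabilityTheory.stdGaussian E with hμ
  have hid : MemLp (id : E → E) 2 μ := ProbabilityTheory.IsGaussian.memLp_two_id
  have hL0 : 0 ≤ L := (norm_nonneg _).trans (hL 0)
  have hx2 : Integrable (fun x : E => ‖x‖ ^ 2) μ := hid.integrable_norm_pow (by norm_num)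
  have hfst : Integrable (fun z : E × E => ‖z.1‖ ^ 2) (μ.prod μ) := hx2.comp_fst μ
  have hsnd : Integrable (fun z : E × E => ‖z.2‖ ^ 2) (μ.prod μ) := hx2.comp_snd μ
  have hb : ∀ a b : E, ⟪p a, b⟫ ^ 2 ≤ L ^ 2 * ‖b‖ ^ 2 := fun a b => by
    rw [← mul_pow, ← sq_abs]
    exact pow_le_pow_left₀ (abs_nonneg _) ((abs_real_inner_le_norm _ _).trans
      (mul_le_mul_of_nonneg_right (hL a) (norm_nonneg _))) 2
  have hpyI : Integrable (fun z : E × E => ⟪p z.1, z.2⟫ ^ 2) (μ.prod μ) := by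
    refine (hsnd.const_mul (L ^ 2)).mono' (by fun_prop) (Eventually.of_forall fun z => ?_)
    rw [Real.norm_eq_abs, abs_of_nonneg (sq_nonneg _)]
    exact hb _ _
  have hpy : ∫ z : E × E, ⟪p z.1, z.2⟫ ^ 2 ∂(μ.prod μ) ≤ L ^ 2 := by
    rw [integral_prod _ hpyI]
    simp_rw [hμ, integral_inner_sq_stdGaussian]
    rw [← hμ]
    calc ∫ x, ‖p x‖ ^ 2 ∂μ ≤ ∫ x, L ^ 2 ∂μ := by
          refine integral_mono_of_nonneg (Eventually.of_forall fun x => by positivity)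
            (integrable_const _) (Eventually.of_forall fun x => ?_)
          exact pow_le_pow_left₀ (norm_nonneg _) (hL x) 2
      _ = L ^ 2 := by simp
  have hA : ∀ e : ℝ, Integrable (fun z : E × E => ⟪p z.1, cos e • z.1 + sin e • z.2 - z.1⟫ ^ 2)
        (μ.prod μ) ∧ ∫ z : E × E, ⟪p z.1, cos e • z.1 + sin e • z.2 - z.1⟫ ^ 2 ∂(μ.prod μ)
        ≤ 2 * (1 - cos e) ^ 2 * L ^ 2 * (∫ x, ‖x‖ ^ 2 ∂μ) + 2 * sin e ^ 2 * L ^ 2 := by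
    intro e
    have hpt : ∀ z : E × E, ⟪p z.1, cos e • z.1 + sin e • z.2 - z.1⟫ ^ 2 ≤
        2 * (1 - cos e) ^ 2 * L ^ 2 * ‖z.1‖ ^ 2 + 2 * sin e ^ 2 * ⟪p z.1, z.2⟫ ^ 2 := by
      intro z
      have h1 := hb z.1 z.1
      have h2 : ⟪p z.1, cos e • z.1 + sin e • z.2 - z.1⟫ =
          -(1 - cos e) * ⟪p z.1, z.1⟫ + sin e * ⟪p z.1, z.2⟫ := by
        rw [inner_sub_right, inner_add_right, inner_smul_right, inner_smul_right]; ring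
      rw [h2]
      have h3 := mul_le_mul_of_nonneg_left h1 (sq_nonneg (1 - cos e))
      nlinarith [sq_nonneg (-(1 - cos e) * ⟪p z.1, z.1⟫ - sin e * ⟪p z.1, z.2⟫)]
    have hI : Integrable (fun z : E × E => 2 * (1 - cos e) ^ 2 * L ^ 2 * ‖z.1‖ ^ 2
        + 2 * sin e ^ 2 * ⟪p z.1, z.2⟫ ^ 2) (μ.prod μ) :=
      (hfst.const_mul _).add (hpyI.const_mul _)
    refine ⟨hI.mono' (by fun_prop) (Eventually.of_forall fun z => ?_), ?_⟩
    · rw [Real.norm_eq_abs, abs_of_nonneg (sq_nonneg _)]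
      exact hpt z
    · refine (integral_mono_of_nonneg (Eventually.of_forall fun z => sq_nonneg _) hI
        (Eventually.of_forall hpt)).trans ?_
      rw [integral_add (hfst.const_mul _) (hpyI.const_mul _), integral_const_mul,
        integral_const_mul, integral_fun_fst (fun x : E => ‖x‖ ^ 2)]
      simp only [probReal_univ, one_smul]
      have := mul_le_mul_of_nonneg_left hpy (by positivity : 0 ≤ 2 * sin e ^ 2)
      linarith
  have hrot := measurePreserving_rotation_stdGaussian (E := E) ε
  rw [← hμ] at hrot
  have hback : ∀ z : E × E, cos (-ε) • (ContinuousLinearMap.rotation ε z).1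
      + sin (-ε) • (ContinuousLinearMap.rotation ε z).2 = z.1 := by
    intro z
    simp only [ContinuousLinearMap.rotation_apply, cos_neg, sin_neg, smul_add, smul_smul]
    have h1 := cos_sq_add_sin_sq ε
    have : z.1 = (cos ε ^ 2 + sin ε ^ 2) • z.1 := by rw [h1, one_smul]
    conv_rhs => rw [this]
    module
  have hsecond : ∀ z : E × E,
      (fun z : E × E => ⟪p z.1, cos (-ε) • z.1 + sin (-ε) • z.2 - z.1⟫ ^ 2)
        (ContinuousLinearMap.rotation ε z) =
      ⟪p (cos ε • z.1 + sin ε • z.2), z.1 - (cos ε • z.1 + sin ε • z.2)⟫ ^ 2 := by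
    intro z
    beta_reduce
    rw [hback z]
    simp only [ContinuousLinearMap.rotation_apply]
  have hBI : Integrable (fun z : E × E =>
      ⟪p (cos ε • z.1 + sin ε • z.2), z.1 - (cos ε • z.1 + sin ε • z.2)⟫ ^ 2) (μ.prod μ) := by
    have := hrot.integrable_comp_of_integrable (hA (-ε)).1
    refine this.congr (Eventually.of_forall hsecond)
  have hB : ∫ z : E × E,
      ⟪p (cos ε • z.1 + sin ε • z.2), z.1 - (cos ε • z.1 + sin ε • z.2)⟫ ^ 2 ∂(μ.prod μ)
      ≤ 2 * (1 - cos ε) ^ 2 * L ^ 2 * (∫ x, ‖x‖ ^ 2 ∂μ) + 2 * sin ε ^ 2 * L ^ 2 := by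
    have h1 := (hA (-ε)).2
    have h2 := integral_map (μ := μ.prod μ) hrot.measurable.aemeasurable
      (f := fun z : E × E => ⟪p z.1, cos (-ε) • z.1 + sin (-ε) • z.2 - z.1⟫ ^ 2) (by fun_prop)
    rw [hrot.map_eq] at h2
    rw [h2, integral_congr_ae (Eventually.of_forall hsecond)] at h1
    simpa using h1
  have hmain : ∫ z : E × E, (f z.1 - f (cos ε • z.1 + sin ε • z.2)) ^ 2 ∂(μ.prod μ) ≤
      ∫ z : E × E, (⟪p z.1, cos ε • z.1 + sin ε • z.2 - z.1⟫ ^ 2 +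
       ⟪p (cos ε • z.1 + sin ε • z.2), z.1 - (cos ε • z.1 + sin ε • z.2)⟫ ^ 2) ∂(μ.prod μ) := by
    refine integral_mono_of_nonneg (Eventually.of_forall fun z => sq_nonneg _)
      ((hA ε).1.add hBI) (Eventually.of_forall fun z => ?_)
    have h1 := hsub z.1 (cos ε • z.1 + sin ε • z.2)
    have h2 := hsub (cos ε • z.1 + sin ε • z.2) z.1
    beta_reduce
    rcases le_total (f z.1) (f (cos ε • z.1 + sin ε • z.2)) with h | h
    · nlinarith [sq_nonneg (⟪p z.1, cos ε • z.1 + sin ε • z.2 - z.1⟫)]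
    · nlinarith [sq_nonneg
        (⟪p (cos ε • z.1 + sin ε • z.2), z.1 - (cos ε • z.1 + sin ε • z.2)⟫)]
  rw [integral_add (hA ε).1 hBI] at hmain
  linarith [(hA ε).2]

lemma integral_sub_sq_prod_le {f : E → ℝ} {p : E → E} (hf : Measurable f) (hp : Measurable p)
    {L : ℝ} (hL : ∀ x, ‖p x‖ ≤ L) (hsub : ∀ x y, f x + ⟪p x, y - x⟫ ≤ f y) :
    ∫ z : E × E, (f z.1 - f z.2) ^ 2
      ∂((ProbabilityTheory.stdGaussian E).prod (ProbabilityTheory.stdGaussian E)) ≤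
    π ^ 2 * L ^ 2 := by
  set μ := ProbabilityTheory.stdGaussian E with hμ
  have hf2 : MemLp f 2 μ := memLp_of_subgradient hf hL hsub
  set m := ∫ x, ‖x‖ ^ 2 ∂μ with hm
  have hX : ∀ θ : ℝ, MemLp (fun z : E × E => f (cos θ • z.1 + sin θ • z.2)) 2 (μ.prod μ) := by
    intro θ
    have h1 := (hf2.comp_fst μ).comp_measurePreserving (measurePreserving_rotation_stdGaussian θ)
    refine h1.ae_eq (Eventually.of_forall fun z => ?_)
    simp [ContinuousLinearMap.rotation_apply]
  have hstat : ∀ α ε : ℝ, ∫ z : E × E, (f (cos α • z.1 + sin α • z.2)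
      - f (cos (α + ε) • z.1 + sin (α + ε) • z.2)) ^ 2 ∂(μ.prod μ) =
      ∫ z : E × E, (f z.1 - f (cos ε • z.1 + sin ε • z.2)) ^ 2 ∂(μ.prod μ) := by
    intro α ε
    have hrot := measurePreserving_rotation_stdGaussian (E := E) α
    rw [← hμ] at hrot
    have h2 := integral_map (μ := μ.prod μ) hrot.measurable.aemeasurable
      (f := fun z : E × E => (f z.1 - f (cos ε • z.1 + sin ε • z.2)) ^ 2) (by fun_prop)
    rw [hrot.map_eq] at h2
    rw [h2]
    refine integral_congr_ae (Eventually.of_forall fun z => ?_)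
    have : cos (α + ε) • z.1 + sin (α + ε) • z.2 =
        cos ε • (cos α • z.1 + sin α • z.2) + sin ε • (-sin α • z.1 + cos α • z.2) := by
      rw [cos_add, sin_add]; module
    simp only [ContinuousLinearMap.rotation_apply, this]
  have hK : ∀ K : ℕ, 0 < K → ∫ z : E × E, (f z.1 - f z.2) ^ 2 ∂(μ.prod μ) ≤
      π ^ 2 * L ^ 2 + (π ^ 4 / 16 * L ^ 2 * m) * (1 / (K : ℝ)) ^ 2 := by
    intro K hKpos
    have hK' : (0 : ℝ) < K := by exact_mod_cast hKpos
    set ε : ℝ := π / 2 / K with hε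
    have hKε : K * ε = π / 2 := by rw [hε]; field_simp
    let Y : ℕ → E × E → ℝ := fun k z => f (cos (k * ε) • z.1 + sin (k * ε) • z.2)
    have hYI : ∀ k, Integrable (fun z => (Y k z - Y (k + 1) z) ^ 2) (μ.prod μ) := fun k =>
      ((hX (k * ε)).sub (hX ((k + 1 : ℕ) * ε))).integrable_sq
    have h0 : ∀ z : E × E, (f z.1 - f z.2) ^ 2 ≤
        K * ∑ k ∈ Finset.range K, (Y k z - Y (k + 1) z) ^ 2 := by
      intro z
      have h1 : f z.1 - f z.2 = ∑ k ∈ Finset.range K, (Y k z - Y (k + 1) z) := by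
        rw [Finset.sum_range_sub' (fun k => Y k z) K]
        simp [Y, hKε]
      rw [h1]
      simpa using sq_sum_le_card_mul_sum_sq (s := Finset.range K)
        (f := fun k => Y k z - Y (k + 1) z)
    have h1 : ∫ z : E × E, (f z.1 - f z.2) ^ 2 ∂(μ.prod μ) ≤
        ∫ z : E × E, K * ∑ k ∈ Finset.range K, (Y k z - Y (k + 1) z) ^ 2 ∂(μ.prod μ) :=
      integral_mono_of_nonneg (Eventually.of_forall fun z => sq_nonneg _)
        ((integrable_finsetSum _ fun k _ => hYI k).const_mul _) (Eventually.of_forall h0)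
    rw [integral_const_mul, integral_finsetSum _ fun k _ => hYI k] at h1
    have h2 : ∀ k ∈ Finset.range K, ∫ z, (Y k z - Y (k + 1) z) ^ 2 ∂(μ.prod μ) ≤
        4 * (1 - cos ε) ^ 2 * L ^ 2 * m + 4 * sin ε ^ 2 * L ^ 2 := by
      intro k _
      have h3 := hstat (k * ε) ε
      have h4 := integral_sub_sq_rotation_le hp hL hsub ε
      rw [← hμ, ← hm, ← h3] at h4
      refine le_trans (le_of_eq ?_) h4
      refine integral_congr_ae (Eventually.of_forall fun z => ?_)
      simp only [Y]
      push_cast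
      rw [add_mul, one_mul]
    have h3 := Finset.sum_le_sum h2
    rw [Finset.sum_const, Finset.card_range, nsmul_eq_mul] at h3
    have hm0 : 0 ≤ m := integral_nonneg fun x => by positivity
    have hc1 : (1 - cos ε) ^ 2 ≤ (ε ^ 2 / 2) ^ 2 := by
      refine pow_le_pow_left₀ (by linarith [cos_le_one ε]) ?_ 2
      linarith [one_sub_sq_div_two_le_cos (x := ε)]
    have hs1 : sin ε ^ 2 ≤ ε ^ 2 := sin_sq_le_sq
    have h4 := mul_le_mul_of_nonneg_left h3 hK'.le
    have h5 : 4 * (1 - cos ε) ^ 2 * L ^ 2 * m + 4 * sin ε ^ 2 * L ^ 2 ≤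
        ε ^ 4 * L ^ 2 * m + 4 * ε ^ 2 * L ^ 2 := by
      have := mul_le_mul_of_nonneg_right hc1 (mul_nonneg (sq_nonneg L) hm0)
      have := mul_le_mul_of_nonneg_right hs1 (sq_nonneg L)
      nlinarith
    have h6 := mul_le_mul_of_nonneg_left h5 (mul_nonneg hK'.le hK'.le)
    have h7 : K * K * (ε ^ 4 * L ^ 2 * m + 4 * ε ^ 2 * L ^ 2) =
        π ^ 2 * L ^ 2 + (π ^ 4 / 16 * L ^ 2 * m) * (1 / (K : ℝ)) ^ 2 := by
      rw [hε]; field_simp; ring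
    linarith
  have hlim : Tendsto (fun K : ℕ => π ^ 2 * L ^ 2
      + (π ^ 4 / 16 * L ^ 2 * m) * (1 / (K : ℝ)) ^ 2) atTop
      (nhds (π ^ 2 * L ^ 2 + (π ^ 4 / 16 * L ^ 2 * m) * 0 ^ 2)) :=
    ((tendsto_one_div_atTop_nhds_zero_nat.pow 2).const_mul _).const_add _
  have := ge_of_tendsto hlim ((eventually_gt_atTop 0).mono hK)
  simpa using this

/-- A convex function with subgradients bounded by `L` has Gaussian variance at most `5 L²`. -/
theorem integral_sub_integral_sq_le_of_subgradient {f : E → ℝ} {p : E → E} (hf : Measurable f)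
    (hp : Measurable p) {L : ℝ} (hL : ∀ x, ‖p x‖ ≤ L)
    (hsub : ∀ x y, f x + ⟪p x, y - x⟫ ≤ f y) :
    ∫ x, (f x - ∫ y, f y ∂(ProbabilityTheory.stdGaussian E)) ^ 2
      ∂(ProbabilityTheory.stdGaussian E) ≤ 5 * L ^ 2 := by
  have hmain := integral_sub_sq_prod_le hf hp hL hsub
  set μ := ProbabilityTheory.stdGaussian E with hμ
  have hf2 : MemLp f 2 μ := memLp_of_subgradient hf hL hsub
  have hf1 : Integrable f μ := hf2.integrable (by norm_num)
  have hfs : Integrable (fun x => f x ^ 2) μ := hf2.integrable_sq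
  set c := ∫ y, f y ∂μ with hc
  have h1 : ∫ x, (f x - c) ^ 2 ∂μ = ∫ x, f x ^ 2 ∂μ - c ^ 2 := by
    have : ∀ x, (f x - c) ^ 2 = f x ^ 2 - 2 * c * f x + c ^ 2 := fun x => by ring
    simp_rw [this]
    have hI : Integrable (fun x => f x ^ 2 - 2 * c * f x) μ := hfs.sub (hf1.const_mul _)
    rw [integral_add hI (integrable_const _), integral_sub hfs (hf1.const_mul _), integral_const_mul, ← hc]
    simp; ring
  have h2 : ∫ z : E × E, (f z.1 - f z.2) ^ 2 ∂(μ.prod μ) = 2 * (∫ x, f x ^ 2 ∂μ) - 2 * c ^ 2 := by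
    have : ∀ z : E × E, (f z.1 - f z.2) ^ 2 = f z.1 ^ 2 + f z.2 ^ 2 - 2 * (f z.1 * f z.2) :=
      fun z => by ring
    simp_rw [this]
    have hI : Integrable (fun z : E × E => f z.1 ^ 2 + f z.2 ^ 2) (μ.prod μ) :=
      (hfs.comp_fst μ).add (hfs.comp_snd μ)
    rw [integral_sub hI ((hf1.mul_prod hf1).const_mul _),
      integral_add (hfs.comp_fst μ) (hfs.comp_snd μ), integral_const_mul, integral_prod_mul,
      integral_fun_fst (fun x : E => f x ^ 2), integral_fun_snd (fun x : E => f x ^ 2), ← hc]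
    simp; ring
  rw [h1]
  rw [h2] at hmain
  have : π ^ 2 ≤ 10 := by nlinarith [pi_lt_d2, pi_pos]
  nlinarith [sq_nonneg L]

end GaussianVariance

section LogPartition

variable {Ω : Type*} [MeasurableSpace Ω] {P : Measure Ω} [IsProbabilityMeasure P]

lemma memLp_top_exp {h : Ω → ℝ} (hh : MemLp h ⊤ P) : MemLp (fun w => exp (h w)) ⊤ P := by
  refine memLp_top_of_bound (continuous_exp.comp_aestronglyMeasurable hh.1)
    (exp (eLpNormEssSup h P).toReal) ?_
  filter_upwards [ae_le_eLpNormEssSup (f := h) (μ := P)] with w hw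
  rw [Real.norm_eq_abs, abs_exp]
  refine exp_le_exp.2 ((le_abs_self _).trans ?_)
  have h1 : eLpNormEssSup h P ≠ ⊤ := by
    have := hh.eLpNorm_ne_top; rwa [eLpNorm_exponent_top] at this
  have := ENNReal.toReal_mono h1 hw
  simpa using this

lemma integrable_exp_of_memLp_top {h : Ω → ℝ} (hh : MemLp h ⊤ P) :
    Integrable (fun w => exp (h w)) P := (memLp_top_exp hh).integrable le_top

lemma isProbabilityMeasure_tilted_of_memLp_top {h : Ω → ℝ} (hh : MemLp h ⊤ P) :
    IsProbabilityMeasure (P.tilted h) :=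
  isProbabilityMeasure_tilted (integrable_exp_of_memLp_top hh)

lemma memLp_top_tilted {F : Type*} [NormedAddCommGroup F] {f : Ω → F} {h : Ω → ℝ}
    (hf : MemLp f ⊤ P) : MemLp f ⊤ (P.tilted h) := by
  have hac := tilted_absolutelyContinuous P h
  refine ⟨hf.1.mono_ac hac, ?_⟩
  have h1 := hf.2
  rw [eLpNorm_exponent_top] at h1 ⊢
  exact (eLpNormEssSup_mono_measure f hac).trans_lt h1

/-- The tangent inequality (Jensen) for the log-partition function. -/
lemma log_integral_exp_add_le {h k : Ω → ℝ} (hh : MemLp h ⊤ P) (hk : MemLp k ⊤ P) :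
    log (∫ w, exp (h w) ∂P) + ∫ w, (k w - h w) ∂(P.tilted h) ≤ log (∫ w, exp (k w) ∂P) := by
  have := isProbabilityMeasure_tilted_of_memLp_top hh
  have hhpos := integral_exp_pos (integrable_exp_of_memLp_top hh)
  have hkpos := integral_exp_pos (integrable_exp_of_memLp_top hk)
  have hkh : MemLp (fun w => k w - h w) ⊤ (P.tilted h) := memLp_top_tilted (hk.sub hh)
  set m := ∫ w, (k w - h w) ∂(P.tilted h) with hm
  have h1 : ∫ w, exp (k w - h w) ∂(P.tilted h)
      = (∫ w, exp (k w) ∂P) / ∫ w, exp (h w) ∂P := by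
    rw [integral_exp_tilted (f := h) (fun w => k w - h w)]
    congr 1
    refine integral_congr_ae (Eventually.of_forall fun w => ?_)
    simp
  have hI : Integrable (fun w => k w - h w) (P.tilted h) := hkh.integrable le_top
  have hIe := integrable_exp_of_memLp_top hkh
  have h2 : exp m ≤ ∫ w, exp (k w - h w) ∂(P.tilted h) :=
    convexOn_exp.map_integral_le continuous_exp.continuousOn isClosed_univ
      (Eventually.of_forall fun w => mem_univ _) hI hIe
  rw [h1, le_div_iff₀ hhpos] at h2
  have h3 := log_le_log (by positivity) h2
  rw [log_mul (exp_pos _).ne' hhpos.ne', log_exp] at h3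
  linarith

variable {E : Type*} [NormedAddCommGroup E] [InnerProductSpace ℝ E] [FiniteDimensional ℝ E]
  [MeasurableSpace E] [BorelSpace E]

lemma memLp_top_add_inner {A : Ω → ℝ} {φ : Ω → E} (hA : MemLp A ⊤ P) (hφ : MemLp φ ⊤ P) (g : E) :
    MemLp (fun w => A w + ⟪φ w, g⟫) ⊤ P :=
  hA.add (hφ.inner_const g)

lemma measurable_integral_exp {A : Ω → ℝ} {φ : Ω → E} (hA : Measurable A) (hφ : Measurable φ) :
    Measurable fun g : E => ∫ w, exp (A w + ⟪φ w, g⟫) ∂P := by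
  have : StronglyMeasurable (Function.uncurry fun (g : E) (w : Ω) => exp (A w + ⟪φ w, g⟫)) :=
    Measurable.stronglyMeasurable (by fun_prop)
  exact this.integral_prod_right.measurable

lemma measurable_integral_tilted {F : Type*} [NormedAddCommGroup F] [NormedSpace ℝ F]
    [CompleteSpace F] [MeasurableSpace F] [BorelSpace F] [SecondCountableTopology F]
    {A : Ω → ℝ} {φ : Ω → E} (hA : Measurable A) (hφ : Measurable φ) {f : E → Ω → F}
    (hf : Measurable (Function.uncurry f)) :
    Measurable fun g : E => ∫ w, f g w ∂(P.tilted fun w => A w + ⟪φ w, g⟫) := by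
  have hZ := measurable_integral_exp (P := P) hA hφ
  simp_rw [integral_tilted]
  have : StronglyMeasurable (Function.uncurry fun (g : E) (w : Ω) =>
      (exp (A w + ⟪φ w, g⟫) / ∫ w, exp (A w + ⟪φ w, g⟫) ∂P) • f g w) := by
    refine Measurable.stronglyMeasurable (Measurable.smul ?_ hf)
    exact Measurable.div (by fun_prop) (hZ.comp measurable_fst)
  exact this.integral_prod_right.measurable

lemma norm_integral_tilted_le {F : Type*} [NormedAddCommGroup F] [NormedSpace ℝ F]
    {h : Ω → ℝ} (hh : MemLp h ⊤ P) {f : Ω → F} {C : ℝ} (hf : ∀ᵐ w ∂P, ‖f w‖ ≤ C) :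
    ‖∫ w, f w ∂(P.tilted h)‖ ≤ C := by
  have := isProbabilityMeasure_tilted_of_memLp_top hh
  simpa using norm_integral_le_of_norm_le_const ((tilted_absolutelyContinuous P h).ae_le hf)

lemma log_integral_exp_subgradient {A : Ω → ℝ} {φ : Ω → E} (hA : MemLp A ⊤ P)
    (hφ : MemLp φ ⊤ P) (x y : E) :
    log (∫ w, exp (A w + ⟪φ w, x⟫) ∂P)
      + ⟪∫ w, φ w ∂(P.tilted fun w => A w + ⟪φ w, x⟫), y - x⟫
      ≤ log (∫ w, exp (A w + ⟪φ w, y⟫) ∂P) := by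
  have hx := memLp_top_add_inner hA hφ x
  have := isProbabilityMeasure_tilted_of_memLp_top hx
  have h1 := log_integral_exp_add_le hx (memLp_top_add_inner hA hφ y)
  have hφ' : Integrable φ (P.tilted fun w => A w + ⟪φ w, x⟫) :=
    (memLp_top_tilted hφ).integrable le_top
  have h2 : ⟪∫ w, φ w ∂(P.tilted fun w => A w + ⟪φ w, x⟫), y - x⟫ =
      ∫ w, (A w + ⟪φ w, y⟫ - (A w + ⟪φ w, x⟫)) ∂(P.tilted fun w => A w + ⟪φ w, x⟫) := by
    rw [real_inner_comm, ← integral_inner hφ']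
    refine integral_congr_ae (Eventually.of_forall fun w => ?_)
    beta_reduce
    rw [real_inner_comm, inner_sub_right]; ring
  rwa [h2]

/-- Gaussian concentration of a log-partition function with linear dependence on the noise. -/
lemma log_integral_exp_concentration {A : Ω → ℝ} {φ : Ω → E} (hAm : Measurable A)
    (hφm : Measurable φ) (hA : MemLp A ⊤ P) {L : ℝ} (hφ : ∀ᵐ w ∂P, ‖φ w‖ ≤ L) :
    MemLp (fun g : E => log (∫ w, exp (A w + ⟪φ w, g⟫) ∂P)) 2 (ProbabilityTheory.stdGaussian E) ∧
    ∫ g, (log (∫ w, exp (A w + ⟪φ w, g⟫) ∂P)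
        - ∫ g', log (∫ w, exp (A w + ⟪φ w, g'⟫) ∂P) ∂(ProbabilityTheory.stdGaussian E)) ^ 2
        ∂(ProbabilityTheory.stdGaussian E) ≤ 5 * L ^ 2 := by
  have hφ' : MemLp φ ⊤ P := memLp_top_of_bound hφm.aestronglyMeasurable L hφ
  have hF : Measurable fun g : E => log (∫ w, exp (A w + ⟪φ w, g⟫) ∂P) :=
    measurable_log.comp (measurable_integral_exp hAm hφm)
  have hp : Measurable fun g : E => ∫ w, φ w ∂(P.tilted fun w => A w + ⟪φ w, g⟫) :=
    measurable_integral_tilted hAm hφm (hφm.comp measurable_snd)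
  have hL : ∀ g : E, ‖∫ w, φ w ∂(P.tilted fun w => A w + ⟪φ w, g⟫)‖ ≤ L := fun g =>
    norm_integral_tilted_le (memLp_top_add_inner hA hφ' g) hφ
  exact ⟨memLp_of_subgradient hF hL (log_integral_exp_subgradient hA hφ'),
    integral_sub_integral_sq_le_of_subgradient hF hp hL (log_integral_exp_subgradient hA hφ')⟩

end LogPartition

section Concave

variable {E : Type*} [MeasurableSpace E] {μ : Measure E} [IsProbabilityMeasure μ]

lemma integral_supergradient {G D : ℝ → E → ℝ} (hG : ∀ R, 0 < R → Integrable (G R) μ)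
    (hD : ∀ R, 0 < R → Integrable (D R) μ)
    (hsup : ∀ R R', 0 < R → 0 < R' → ∀ g, G R' g ≤ G R g + (R' - R) * D R g)
    {R R' : ℝ} (hR : 0 < R) (hR' : 0 < R') :
    ∫ g, G R' g ∂μ ≤ ∫ g, G R g ∂μ + (R' - R) * ∫ g, D R g ∂μ := by
  have h1 : Integrable (fun g => (R' - R) * D R g) μ := (hD R hR).const_mul _
  rw [← integral_const_mul, ← integral_add (hG R hR) h1]
  exact integral_mono (hG R' hR') ((hG R hR).add h1) (hsup R R' hR hR')

lemma antitoneOn_of_supergradient {G d : ℝ → ℝ}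
    (hsup : ∀ R R', 0 < R → 0 < R' → G R' ≤ G R + (R' - R) * d R) :
    AntitoneOn d (Ioi 0) := by
  intro x hx y hy hxy
  rcases hxy.eq_or_lt with h | h
  · rw [h]
  have h1 := hsup x y hx hy
  have h2 := hsup y x hy hx
  have h3 : 0 ≤ (y - x) * (d x - d y) := by linarith
  have := nonneg_of_mul_nonneg_right h3 (sub_pos.2 h)
  linarith

/-- Fluctuations of the supergradient of a random concave function, in terms of the fluctuations
of the function itself. -/
lemma integral_supergradient_sub_sq_le {G D : ℝ → E → ℝ}
    (hG : ∀ R, 0 < R → MemLp (G R) 2 μ) (hD : ∀ R, 0 < R → MemLp (D R) 2 μ)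
    (hsup : ∀ R R', 0 < R → 0 < R' → ∀ g, G R' g ≤ G R g + (R' - R) * D R g)
    {V T : ℝ} (hV : ∀ R, 0 < R → R ≤ T → ∫ g, (G R g - ∫ g', G R g' ∂μ) ^ 2 ∂μ ≤ V)
    {R δ : ℝ} (hδ : 0 < δ) (hδR : δ < R) (hRT : R + δ ≤ T) :
    ∫ g, (D R g - ∫ g', D R g' ∂μ) ^ 2 ∂μ ≤ 12 * V / δ ^ 2
      + 4 * (∫ g, D (R - δ) g ∂μ - ∫ g, D (R + δ) g ∂μ) ^ 2 := by
  have hG1 : ∀ R, 0 < R → Integrable (G R) μ := fun R h => (hG R h).integrable (by norm_num)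
  have hD1 : ∀ R, 0 < R → Integrable (D R) μ := fun R h => (hD R h).integrable (by norm_num)
  have hmean : ∀ R R' : ℝ, 0 < R → 0 < R' →
      ∫ g, G R' g ∂μ ≤ ∫ g, G R g ∂μ + (R' - R) * ∫ g, D R g ∂μ := fun R R' h h' =>
    integral_supergradient hG1 hD1 hsup h h'
  have hanti := antitoneOn_of_supergradient (G := fun R => ∫ g, G R g ∂μ)
    (d := fun R => ∫ g, D R g ∂μ) hmean
  have hR : 0 < R := hδ.trans hδR
  have hRm : 0 < R - δ := sub_pos.2 hδR
  have hRp : 0 < R + δ := by linarith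
  set Δ : ℝ → E → ℝ := fun R g => G R g - ∫ g', G R g' ∂μ with hΔ
  set d : ℝ → ℝ := fun R => ∫ g, D R g ∂μ with hd
  have hΔI : ∀ R, 0 < R → Integrable (fun g => Δ R g ^ 2) μ := fun R h =>
    ((hG R h).sub (memLp_const _)).integrable_sq
  have a1 := hanti (show R - δ ∈ Ioi 0 from hRm) (show R ∈ Ioi 0 from hR) (by linarith)
  have a2 := hanti (show R ∈ Ioi 0 from hR) (show R + δ ∈ Ioi 0 from hRp) (by linarith)
  have m1 := hmean (R + δ) R hRp hR
  have m2 := hmean (R - δ) R hRm hR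
  change d R ≤ d (R - δ) at a1
  change d (R + δ) ≤ d R at a2
  change _ ≤ _ + _ * d (R + δ) at m1
  change _ ≤ _ + _ * d (R - δ) at m2
  have hpt : ∀ g, (D R g - d R) ^ 2 ≤ 4 / δ ^ 2 * (Δ (R + δ) g ^ 2 + Δ R g ^ 2 + Δ (R - δ) g ^ 2)
      + 4 * (d (R - δ) - d (R + δ)) ^ 2 := by
    intro g
    have s1 := hsup R (R + δ) hR hRp g
    have s2 := hsup R (R - δ) hR hRm g
    have l1 : δ * (D R g - d R) ≥ -(|Δ (R + δ) g| + |Δ R g| + |Δ (R - δ) g|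
        + δ * (d (R - δ) - d (R + δ))) := by
      have e1 := neg_abs_le (Δ (R + δ) g)
      have e2 := le_abs_self (Δ R g)
      have e3 := abs_nonneg (Δ (R - δ) g)
      have e4 := mul_le_mul_of_nonneg_left a1 hδ.le
      simp only [hΔ] at *
      linarith
    have l2 : δ * (D R g - d R) ≤ |Δ (R + δ) g| + |Δ R g| + |Δ (R - δ) g|
        + δ * (d (R - δ) - d (R + δ)) := by
      have e1 := abs_nonneg (Δ (R + δ) g)
      have e2 := le_abs_self (Δ R g)
      have e3 := neg_abs_le (Δ (R - δ) g)
      have e4 := mul_le_mul_of_nonneg_left a2 hδ.le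
      simp only [hΔ] at *
      linarith
    have l3 := sq_le_sq' l1 l2
    have l4 : ∀ x y z w : ℝ, (x + y + z + w) ^ 2 ≤ 4 * (x ^ 2 + y ^ 2 + z ^ 2 + w ^ 2) := by
      intro x y z w
      nlinarith [sq_nonneg (x - y), sq_nonneg (x - z), sq_nonneg (x - w), sq_nonneg (y - z),
        sq_nonneg (y - w), sq_nonneg (z - w)]
    have l5 := l3.trans (l4 _ _ _ _)
    simp only [sq_abs, mul_pow] at l5
    have l6 : 4 / δ ^ 2 * (Δ (R + δ) g ^ 2 + Δ R g ^ 2 + Δ (R - δ) g ^ 2)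
      + 4 * (d (R - δ) - d (R + δ)) ^ 2 = 4 * (Δ (R + δ) g ^ 2 + Δ R g ^ 2 + Δ (R - δ) g ^ 2
        + δ ^ 2 * (d (R - δ) - d (R + δ)) ^ 2) / δ ^ 2 := by field_simp
    rw [l6, le_div_iff₀ (by positivity)]
    linarith
  have hI1 : Integrable (fun g => Δ (R + δ) g ^ 2 + Δ R g ^ 2) μ := (hΔI _ hRp).add (hΔI _ hR)
  have hI2 : Integrable (fun g => Δ (R + δ) g ^ 2 + Δ R g ^ 2 + Δ (R - δ) g ^ 2) μ :=
    hI1.add (hΔI _ hRm)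
  have hI3 : Integrable (fun g => 4 / δ ^ 2 * (Δ (R + δ) g ^ 2 + Δ R g ^ 2 + Δ (R - δ) g ^ 2)) μ :=
    hI2.const_mul _
  have hI4 : Integrable (fun g => 4 / δ ^ 2 * (Δ (R + δ) g ^ 2 + Δ R g ^ 2 + Δ (R - δ) g ^ 2)
      + 4 * (d (R - δ) - d (R + δ)) ^ 2) μ := hI3.add (integrable_const _)
  refine (integral_mono_of_nonneg (Eventually.of_forall fun g => sq_nonneg _)
    hI4 (Eventually.of_forall hpt)).trans ?_
  rw [integral_add hI3 (integrable_const _), integral_const_mul,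
    integral_add hI1 (hΔI _ hRm), integral_add (hΔI _ hRp) (hΔI _ hR)]
  have v1 := hV (R + δ) hRp hRT
  have v2 := hV R hR (by linarith)
  have v3 := hV (R - δ) hRm (by linarith)
  have v4 := mul_le_mul_of_nonneg_left (add_le_add (add_le_add v1 v2) v3)
    (show 0 ≤ 4 / δ ^ 2 by positivity)
  have v5 : 4 / δ ^ 2 * (V + V + V) = 12 * V / δ ^ 2 := by ring
  simp only [integral_const, probReal_univ, one_smul]
  linarith

lemma integral_sq_sub_shift_le {d : ℝ → ℝ} (hd : AntitoneOn d (Ioi 0)) {a b δ S : ℝ}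
    (hδ : 0 < δ) (hδa : δ < a) (hab : a ≤ b) (hS : ∀ x ∈ Icc (a - δ) (b + δ), |d x| ≤ S) :
    IntervalIntegrable (fun R => (d (R - δ) - d (R + δ)) ^ 2) volume a b ∧
    ∫ R in a..b, (d (R - δ) - d (R + δ)) ^ 2 ≤ 8 * δ * S ^ 2 := by
  have hInt : ∀ x y : ℝ, 0 < x → 0 < y → IntervalIntegrable d volume x y := fun x y hx hy =>
    (hd.mono fun z hz => (lt_min hx hy).trans_le hz.1).intervalIntegrable
  have hS0 : 0 ≤ S := (abs_nonneg _).trans (hS a ⟨by linarith, by linarith⟩)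
  have hm : IntervalIntegrable (fun R => d (R - δ)) volume a b := by
    have := (hInt (a - δ) (b - δ) (by linarith) (by linarith)).comp_sub_right δ
    simpa using this
  have hp : IntervalIntegrable (fun R => d (R + δ)) volume a b := by
    have := (hInt (a + δ) (b + δ) (by linarith) (by linarith)).comp_add_right δ
    simpa using this
  have hmp := hm.sub hp
  have hpt : ∀ R ∈ Icc a b, 0 ≤ d (R - δ) - d (R + δ) ∧ d (R - δ) - d (R + δ) ≤ 2 * S := by
    intro R hR
    have h1 := abs_le.1 (hS (R - δ) ⟨by linarith [hR.1], by linarith [hR.2]⟩)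
    have h2 := abs_le.1 (hS (R + δ) ⟨by linarith [hR.1], by linarith [hR.2]⟩)
    refine ⟨?_, by linarith⟩
    have := hd (show R - δ ∈ Ioi 0 by simp; linarith [hR.1])
      (show R + δ ∈ Ioi 0 by simp; linarith [hR.1]) (by linarith)
    linarith
  have hsq : IntervalIntegrable (fun R => (d (R - δ) - d (R + δ)) ^ 2) volume a b := by
    refine (hmp.const_mul (2 * S)).mono_fun (hmp.aestronglyMeasurable_restrict_uIoc.pow 2) ?_
    refine (ae_restrict_iff' measurableSet_uIoc).2 (Eventually.of_forall fun R hR => ?_)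
    rw [uIoc_of_le hab] at hR
    obtain ⟨h1, h2⟩ := hpt R ⟨hR.1.le, hR.2⟩
    beta_reduce
    rw [Real.norm_eq_abs, Real.norm_eq_abs, abs_of_nonneg (sq_nonneg _),
      abs_of_nonneg (mul_nonneg (by linarith) h1)]
    nlinarith
  refine ⟨hsq, ?_⟩
  have h1 : ∫ R in a..b, (d (R - δ) - d (R + δ)) ^ 2 ≤
      ∫ R in a..b, (2 * S) * (d (R - δ) - d (R + δ)) := by
    refine intervalIntegral.integral_mono_on hab hsq (hmp.const_mul _) fun R hR => ?_
    obtain ⟨h1, h2⟩ := hpt R hR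
    nlinarith
  rw [intervalIntegral.integral_const_mul, intervalIntegral.integral_sub hm hp,
    intervalIntegral.integral_comp_sub_right, intervalIntegral.integral_comp_add_right] at h1
  have h2 : (∫ x in (a - δ)..(b - δ), d x) - ∫ x in (a + δ)..(b + δ), d x =
      (∫ x in (a - δ)..(a + δ), d x) - ∫ x in (b - δ)..(b + δ), d x := by
    have e1 := intervalIntegral.integral_add_adjacent_intervals
      (hInt (a - δ) (b - δ) (by linarith) (by linarith))
      (hInt (b - δ) (b + δ) (by linarith) (by linarith))
    have e2 := intervalIntegral.integral_add_adjacent_intervals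
      (hInt (a - δ) (a + δ) (by linarith) (by linarith))
      (hInt (a + δ) (b + δ) (by linarith) (by linarith))
    linarith
  have h3 : ∀ x, a ≤ x → x ≤ b → |∫ x in (x - δ)..(x + δ), d x| ≤ S * (2 * δ) := by
    intro x hax hxb
    have := intervalIntegral.norm_integral_le_of_norm_le_const (a := x - δ) (b := x + δ)
      (f := d) (C := S) (fun y hy => by
        rw [uIoc_of_le (by linarith)] at hy
        exact hS y ⟨by linarith [hy.1], by linarith [hy.2]⟩)
    rw [Real.norm_eq_abs, show x + δ - (x - δ) = 2 * δ by ring,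
      abs_of_pos (by linarith : (0 : ℝ) < 2 * δ)] at this
    exact this
  have h4 := abs_le.1 (h3 a le_rfl hab)
  have h5 := abs_le.1 (h3 b hab le_rfl)
  rw [h2] at h1
  have h6 : (∫ x in (a - δ)..(a + δ), d x) - ∫ x in (b - δ)..(b + δ), d x ≤ 4 * δ * S := by
    linarith
  have h7 := mul_le_mul_of_nonneg_left h6 (show 0 ≤ 2 * S by linarith)
  nlinarith

/-- Integrating a bound of the form `α + β / R + 8 (d (R - δ) - d (R + δ))²`. No measurability of
the integrand is needed, since a non-integrable function has vanishing integral. -/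
lemma integral_le_of_supergradient_bound {q d : ℝ → ℝ} (hd : AntitoneOn d (Ioi 0))
    {a b δ S α β : ℝ} (hα : 0 ≤ α) (hβ : 0 ≤ β) (hδ : 0 < δ) (hδa : δ < a) (hab : a ≤ b)
    (hS : ∀ x ∈ Icc (a - δ) (b + δ), |d x| ≤ S)
    (hq : ∀ R ∈ Icc a b, q R ≤ α + β / R + 8 * (d (R - δ) - d (R + δ)) ^ 2) :
    ∫ R in a..b, q R ≤ α * (b - a) + β * log (b / a) + 64 * δ * S ^ 2 := by
  have ha : 0 < a := hδ.trans hδa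
  have hb : 0 < b := ha.trans_le hab
  by_cases hqi : IntervalIntegrable q volume a b
  swap
  · rw [intervalIntegral.integral_undef hqi]
    have : 0 ≤ log (b / a) := log_nonneg ((one_le_div ha).2 hab)
    have := sub_nonneg.2 hab
    positivity
  obtain ⟨hsq, hle⟩ := integral_sq_sub_shift_le hd hδ hδa hab hS
  have hinv : IntervalIntegrable (fun R : ℝ => β / R) volume a b := by
    refine ContinuousOn.intervalIntegrable fun x hx => ?_
    rw [uIcc_of_le hab] at hx
    exact (continuousAt_const.div continuousAt_id (ha.trans_le hx.1).ne').continuousWithinAt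
  have h0 : IntervalIntegrable (fun R : ℝ => α + β / R) volume a b :=
    intervalIntegrable_const.add hinv
  refine (intervalIntegral.integral_mono_on hab hqi (h0.add (hsq.const_mul 8)) hq).trans ?_
  rw [intervalIntegral.integral_add h0 (hsq.const_mul 8),
    intervalIntegral.integral_add intervalIntegrable_const hinv,
    intervalIntegral.integral_const_mul, intervalIntegral.integral_const]
  have h1 : ∫ R in a..b, β / R = β * log (b / a) := by
    simp_rw [div_eq_mul_inv β]
    rw [intervalIntegral.integral_const_mul, integral_inv_of_pos ha hb]
  rw [h1, smul_eq_mul]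
  linarith

end Concave

lemma integral_add_sub_integral_sq_le {E : Type*} [MeasurableSpace E] {μ : Measure E}
    [IsProbabilityMeasure μ] {X Y : E → ℝ} (hX : MemLp X 2 μ) (hY : MemLp Y 2 μ) :
    ∫ g, (X g + Y g - ∫ g', (X g' + Y g') ∂μ) ^ 2 ∂μ
      ≤ 2 * ∫ g, (X g - ∫ g', X g' ∂μ) ^ 2 ∂μ + 2 * ∫ g, (Y g - ∫ g', Y g' ∂μ) ^ 2 ∂μ := by
  have hX1 : Integrable X μ := hX.integrable (by norm_num)
  have hY1 : Integrable Y μ := hY.integrable (by norm_num)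
  have hX2 : Integrable (fun g => 2 * (X g - ∫ g', X g' ∂μ) ^ 2) μ :=
    (hX.sub (memLp_const _)).integrable_sq.const_mul 2
  have hY2 : Integrable (fun g => 2 * (Y g - ∫ g', Y g' ∂μ) ^ 2) μ :=
    (hY.sub (memLp_const _)).integrable_sq.const_mul 2
  rw [← integral_const_mul, ← integral_const_mul, ← integral_add hX2 hY2,
    integral_add hX1 hY1]
  refine integral_mono_of_nonneg (Eventually.of_forall fun g => sq_nonneg _) (hX2.add hY2)
    (Eventually.of_forall fun g => ?_)
  beta_reduce
  nlinarith [sq_nonneg ((X g - ∫ g', X g' ∂μ) - (Y g - ∫ g', Y g' ∂μ))]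

lemma integral_const_mul_sub_integral_sq {E : Type*} [MeasurableSpace E] {μ : Measure E}
    (r : ℝ) (X : E → ℝ) :
    ∫ g, (r * X g - ∫ g', r * X g' ∂μ) ^ 2 ∂μ = r ^ 2 * ∫ g, (X g - ∫ g', X g' ∂μ) ^ 2 ∂μ := by
  rw [← integral_const_mul, integral_const_mul]
  congr 1 with g
  ring

/-- A Gibbs weight `exp (B + R c + ⟪φ + √R ψ, g⟫)` with bounded coefficients, linear in a Gaussian
field `g`; `κ` is a convex Lipschitz function dominating `|⟪ψ, g⟫|`, with subgradient `q`. -/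
structure GaussianGibbs {Ω : Type*} [MeasurableSpace Ω] (P : Measure Ω) (E : Type*)
    [NormedAddCommGroup E] [InnerProductSpace ℝ E] [MeasurableSpace E] where
  B : Ω → ℝ
  c : Ω → ℝ
  φ : Ω → E
  ψ : Ω → E
  κ : E → ℝ
  q : E → E
  Cc : ℝ
  Lφ : ℝ
  Lψ : ℝ
  measurable_B : Measurable B
  measurable_c : Measurable c
  measurable_φ : Measurable φ
  measurable_ψ : Measurable ψ
  measurable_κ : Measurable κ
  measurable_q : Measurable q
  memLp_B : MemLp B ⊤ P
  abs_c_le : ∀ᵐ w ∂P, |c w| ≤ Cc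
  norm_φ_le : ∀ᵐ w ∂P, ‖φ w‖ ≤ Lφ
  norm_ψ_le : ∀ᵐ w ∂P, ‖ψ w‖ ≤ Lψ
  norm_q_le : ∀ g, ‖q g‖ ≤ Lψ
  subgradient : ∀ x y, κ x + ⟪q x, y - x⟫ ≤ κ y
  abs_inner_le : ∀ g, ∀ᵐ w ∂P, |⟪ψ w, g⟫| ≤ κ g

namespace GaussianGibbs

variable {Ω : Type*} [MeasurableSpace Ω] {P : Measure Ω} [IsProbabilityMeasure P]
  {E : Type*} [NormedAddCommGroup E] [InnerProductSpace ℝ E] [FiniteDimensional ℝ E]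
  [MeasurableSpace E] [BorelSpace E] (M : GaussianGibbs P E)

/-- The exponent of the Gibbs weight. -/
def H (R : ℝ) (g : E) (w : Ω) : ℝ := M.B w + R * M.c w + ⟪M.φ w + √R • M.ψ w, g⟫

/-- The free entropy. -/
def F (R : ℝ) (g : E) : ℝ := log (∫ w, exp (M.H R g w) ∂P)

/-- Minus the Gibbs average of the derivative in `R` of the exponent. -/
def slope (R : ℝ) (g : E) : ℝ := -∫ w, (M.c w + ⟪M.ψ w, g⟫ / (2 * √R)) ∂(P.tilted (M.H R g))

/-- The concave modification of minus the free entropy. -/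
def G (R : ℝ) (g : E) : ℝ := -M.F R g + √R * M.κ g

/-- The derivative of `G` in `R`. -/
def D (R : ℝ) (g : E) : ℝ := M.slope R g + 1 / (2 * √R) * M.κ g

/-- The expectation of `D`. -/
def meanD (R : ℝ) : ℝ := ∫ g, M.D R g ∂(ProbabilityTheory.stdGaussian E)

lemma memLp_c : MemLp M.c ⊤ P :=
  memLp_top_of_bound M.measurable_c.aestronglyMeasurable M.Cc M.abs_c_le

lemma memLp_φ : MemLp M.φ ⊤ P :=
  memLp_top_of_bound M.measurable_φ.aestronglyMeasurable M.Lφ M.norm_φ_le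

lemma memLp_ψ : MemLp M.ψ ⊤ P :=
  memLp_top_of_bound M.measurable_ψ.aestronglyMeasurable M.Lψ M.norm_ψ_le

lemma memLp_H (R : ℝ) (g : E) : MemLp (M.H R g) ⊤ P :=
  memLp_top_add_inner (M.memLp_B.add (M.memLp_c.const_mul R))
    (M.memLp_φ.add (M.memLp_ψ.const_smul (√R))) g

lemma memLp_κ : MemLp M.κ 2 (ProbabilityTheory.stdGaussian E) :=
  memLp_of_subgradient M.measurable_κ M.norm_q_le M.subgradient

lemma κ_nonneg (g : E) : 0 ≤ M.κ g := by
  obtain ⟨w, hw⟩ := (M.abs_inner_le g).exists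
  exact (abs_nonneg _).trans hw

lemma memLp_F_and_variance_le {R : ℝ} :
    MemLp (M.F R) 2 (ProbabilityTheory.stdGaussian E) ∧
    ∫ g, (M.F R g - ∫ g', M.F R g' ∂(ProbabilityTheory.stdGaussian E)) ^ 2
      ∂(ProbabilityTheory.stdGaussian E) ≤ 5 * (M.Lφ + √R * M.Lψ) ^ 2 := by
  refine log_integral_exp_concentration (A := fun w => M.B w + R * M.c w)
    (φ := fun w => M.φ w + √R • M.ψ w) (M.measurable_B.add (M.measurable_c.const_mul R))
    (M.measurable_φ.add (M.measurable_ψ.const_smul (√R)))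
    (M.memLp_B.add (M.memLp_c.const_mul R)) ?_
  filter_upwards [M.norm_φ_le, M.norm_ψ_le] with w h1 h2
  refine (norm_add_le _ _).trans (add_le_add h1 ?_)
  rw [norm_smul, norm_of_nonneg (sqrt_nonneg R)]
  exact mul_le_mul_of_nonneg_left h2 (sqrt_nonneg R)

lemma variance_κ_le :
    ∫ g, (M.κ g - ∫ g', M.κ g' ∂(ProbabilityTheory.stdGaussian E)) ^ 2
      ∂(ProbabilityTheory.stdGaussian E) ≤ 5 * M.Lψ ^ 2 :=
  integral_sub_integral_sq_le_of_subgradient M.measurable_κ M.measurable_q M.norm_q_le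
    M.subgradient

lemma abs_slope_le (R : ℝ) (g : E) : |M.slope R g| ≤ M.Cc + M.κ g / (2 * √R) := by
  unfold slope
  rw [abs_neg]
  refine norm_integral_tilted_le (M.memLp_H R g)
    (f := fun w => M.c w + ⟪M.ψ w, g⟫ / (2 * √R)) ?_
  filter_upwards [M.abs_c_le, M.abs_inner_le g] with w h1 h2
  refine (abs_add_le _ _).trans (add_le_add h1 ?_)
  rw [abs_div, abs_of_nonneg (show 0 ≤ 2 * √R by positivity)]
  gcongr

lemma measurable_slope (R : ℝ) : Measurable (M.slope R) := by
  refine Measurable.neg ?_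
  refine measurable_integral_tilted (A := fun w => M.B w + R * M.c w)
    (φ := fun w => M.φ w + √R • M.ψ w) (M.measurable_B.add (M.measurable_c.const_mul R))
    (M.measurable_φ.add (M.measurable_ψ.const_smul (√R)))
    (f := fun g w => M.c w + ⟪M.ψ w, g⟫ / (2 * √R)) ?_
  have h1 := M.measurable_c
  have h2 := M.measurable_ψ
  fun_prop

lemma memLp_slope (R : ℝ) : MemLp (M.slope R) 2 (ProbabilityTheory.stdGaussian E) := by
  have h1 : MemLp (fun g => (2 * √R)⁻¹ * M.κ g) 2 (ProbabilityTheory.stdGaussian E) :=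
    M.memLp_κ.const_mul _
  have h2 : MemLp (fun _ => M.Cc) 2 (ProbabilityTheory.stdGaussian E) := memLp_const _
  refine (h2.add h1).mono' (M.measurable_slope R).aestronglyMeasurable
    (Eventually.of_forall fun g => (M.abs_slope_le R g).trans_eq ?_)
  rw [Pi.add_apply, div_eq_inv_mul]

lemma memLp_D (R : ℝ) : MemLp (M.D R) 2 (ProbabilityTheory.stdGaussian E) :=
  (M.memLp_slope R).add (M.memLp_κ.const_mul _)

lemma G_le {R R' : ℝ} (hR : 0 < R) (hR' : 0 < R') (g : E) :
    M.G R' g ≤ M.G R g + (R' - R) * M.D R g := by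
  have hH := M.memLp_H R g
  have := isProbabilityMeasure_tilted_of_memLp_top hH
  have key := log_integral_exp_add_le hH (M.memLp_H R' g)
  set ν := P.tilted (M.H R g) with hν
  set s := √R with hs
  set s' := √R' with hs'
  have hs0 : 0 < s := sqrt_pos.2 hR
  have hs0' : 0 < s' := sqrt_pos.2 hR'
  have e1 : R = s ^ 2 := (sq_sqrt hR.le).symm
  have e2 : R' = s' ^ 2 := (sq_sqrt hR'.le).symm
  have hη : s' - s - (R' - R) / (2 * s) ≤ 0 := by
    rw [e1, e2]
    have : s' - s - (s' ^ 2 - s ^ 2) / (2 * s) = -((s' - s) ^ 2 / (2 * s)) := by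
      field_simp; ring
    rw [this]
    exact neg_nonpos.2 (by positivity)
  have hψ : MemLp (fun w => ⟪M.ψ w, g⟫) ⊤ ν := memLp_top_tilted (M.memLp_ψ.inner_const g)
  have hψI : Integrable (fun w => ⟪M.ψ w, g⟫) ν := hψ.integrable le_top
  have hcI : Integrable M.c ν := (memLp_top_tilted M.memLp_c).integrable le_top
  have hslI : Integrable (fun w => M.c w + ⟪M.ψ w, g⟫ / (2 * s)) ν :=
    hcI.add (hψI.div_const _)
  have h1 : ∫ w, (M.H R' g w - M.H R g w) ∂ν =
      (R' - R) * (-M.slope R g) + (s' - s - (R' - R) / (2 * s)) * ∫ w, ⟪M.ψ w, g⟫ ∂ν := by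
    unfold slope
    rw [neg_neg, ← integral_const_mul, ← integral_const_mul, ← integral_add
      (hslI.const_mul _) (hψI.const_mul _)]
    congr 1 with w
    simp only [H, inner_add_left, real_inner_smul_left, ← hs, ← hs']
    field_simp
    ring
  have h2 : ∫ w, ⟪M.ψ w, g⟫ ∂ν ≤ M.κ g := by
    refine (le_abs_self _).trans ?_
    exact norm_integral_tilted_le hH (f := fun w => ⟪M.ψ w, g⟫) (M.abs_inner_le g)
  have h3 := mul_le_mul_of_nonpos_left h2 hη
  have h4 : (R' - R) * (1 / (2 * s) * M.κ g) = (R' - R) / (2 * s) * M.κ g := by ring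
  unfold G D F
  rw [← hs, ← hs', mul_add, h4]
  linarith

lemma memLp_G (R : ℝ) : MemLp (M.G R) 2 (ProbabilityTheory.stdGaussian E) :=
  (M.memLp_F_and_variance_le (R := R)).1.neg.add (M.memLp_κ.const_mul _)

lemma variance_G_le {R T : ℝ} (hR : 0 < R) (hRT : R ≤ T) :
    ∫ g, (M.G R g - ∫ g', M.G R g' ∂(ProbabilityTheory.stdGaussian E)) ^ 2
      ∂(ProbabilityTheory.stdGaussian E) ≤ 20 * M.Lφ ^ 2 + 30 * T * M.Lψ ^ 2 := by
  obtain ⟨hF, hv⟩ := M.memLp_F_and_variance_le (R := R)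
  refine (integral_add_sub_integral_sq_le hF.neg (M.memLp_κ.const_mul (√R))).trans ?_
  have h1 := integral_const_mul_sub_integral_sq (μ := ProbabilityTheory.stdGaussian E) (-1) (M.F R)
  simp only [neg_one_mul] at h1
  simp only [Pi.neg_apply]
  rw [h1, integral_const_mul_sub_integral_sq, sq_sqrt hR.le]
  have h2 := mul_le_mul_of_nonneg_left M.variance_κ_le hR.le
  have h3 : R * M.Lψ ^ 2 ≤ T * M.Lψ ^ 2 := mul_le_mul_of_nonneg_right hRT (sq_nonneg _)
  have h4 : (M.Lφ + √R * M.Lψ) ^ 2 ≤ 2 * M.Lφ ^ 2 + 2 * (R * M.Lψ ^ 2) := by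
    have : (√R * M.Lψ) ^ 2 = R * M.Lψ ^ 2 := by rw [mul_pow, sq_sqrt hR.le]
    nlinarith [sq_nonneg (M.Lφ - √R * M.Lψ)]
  linarith

lemma antitoneOn_meanD : AntitoneOn M.meanD (Ioi 0) :=
  antitoneOn_of_supergradient (G := fun R => ∫ g, M.G R g ∂(ProbabilityTheory.stdGaussian E))
    fun _ _ h h' => integral_supergradient
      (fun R _ => (M.memLp_G R).integrable (by norm_num))
      (fun R _ => (M.memLp_D R).integrable (by norm_num))
      (fun _ _ h h' g => M.G_le h h' g) h h'

lemma abs_meanD_le {R : ℝ} (hR : 0 < R) :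
    |M.meanD R| ≤ M.Cc + (∫ g, M.κ g ∂(ProbabilityTheory.stdGaussian E)) / √R := by
  have hκ : Integrable M.κ (ProbabilityTheory.stdGaussian E) := M.memLp_κ.integrable (by norm_num)
  have h0 := sqrt_pos.2 hR
  have h : Integrable (fun g => M.Cc + M.κ g / √R) (ProbabilityTheory.stdGaussian E) :=
    (integrable_const _).add (hκ.div_const _)
  have := norm_integral_le_of_norm_le h (f := M.D R) (Eventually.of_forall fun g => ?_)
  · rw [integral_add (integrable_const _) (hκ.div_const _), integral_div] at this
    simpa [meanD] using this
  · refine (abs_add_le _ _).trans ?_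
    have h1 := M.abs_slope_le R g
    rw [abs_of_nonneg (show 0 ≤ 1 / (2 * √R) * M.κ g from mul_nonneg (by positivity) (M.κ_nonneg g))]
    have h2 : M.κ g / √R = M.κ g / (2 * √R) + 1 / (2 * √R) * M.κ g := by field_simp; ring
    linarith

lemma variance_slope_le {R δ T : ℝ} (hδ : 0 < δ) (hδR : δ < R) (hRT : R + δ ≤ T) :
    ∫ g, (M.slope R g - ∫ g', M.slope R g' ∂(ProbabilityTheory.stdGaussian E)) ^ 2
      ∂(ProbabilityTheory.stdGaussian E) ≤
      24 * (20 * M.Lφ ^ 2 + 30 * T * M.Lψ ^ 2) / δ ^ 2 + 5 * M.Lψ ^ 2 / 2 / R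
        + 8 * (M.meanD (R - δ) - M.meanD (R + δ)) ^ 2 := by
  have hR : 0 < R := hδ.trans hδR
  have h1 := integral_supergradient_sub_sq_le (fun R _ => M.memLp_G R) (fun R _ => M.memLp_D R)
    (fun _ _ h h' g => M.G_le h h' g) (fun R h h' => M.variance_G_le h h') hδ hδR hRT
  have h2 := integral_add_sub_integral_sq_le (M.memLp_D R)
    (M.memLp_κ.const_mul (-(1 / (2 * √R))))
  rw [integral_const_mul_sub_integral_sq] at h2
  have h3 : ∀ g, M.D R g + -(1 / (2 * √R)) * M.κ g = M.slope R g := fun g => by unfold D; ring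
  simp only [h3] at h2
  have h4 : (-(1 / (2 * √R))) ^ 2 = 1 / 4 / R := by
    rw [neg_sq, div_pow, mul_pow, sq_sqrt hR.le]; field_simp; norm_num
  rw [h4] at h2
  have h5 := mul_le_mul_of_nonneg_left M.variance_κ_le (show 0 ≤ 1 / 4 / R by positivity)
  have h6 : 1 / 4 / R * (5 * M.Lψ ^ 2) = 5 * M.Lψ ^ 2 / 2 / R / 2 := by ring
  have h7 : 24 * (20 * M.Lφ ^ 2 + 30 * T * M.Lψ ^ 2) / δ ^ 2
    = 2 * (12 * (20 * M.Lφ ^ 2 + 30 * T * M.Lψ ^ 2) / δ ^ 2) := by ring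
  change _ ≤ _ + 4 * (M.meanD (R - δ) - M.meanD (R + δ)) ^ 2 at h1
  rw [h7]
  linarith

end GaussianGibbs

section Rotation

open Matrix
open scoped Kronecker

variable {ι : Type*} [Fintype ι] [DecidableEq ι]

lemma dotProduct_mulVec_of_mem_orthogonalGroup {O : Matrix ι ι ℝ}
    (hO : O ∈ orthogonalGroup ι ℝ) (x y : ι → ℝ) : (O *ᵥ x) ⬝ᵥ (O *ᵥ y) = x ⬝ᵥ y := by
  rw [dotProduct_mulVec, vecMul_mulVec, ← dotProduct_mulVec,
    (mem_orthogonalGroup_iff' ι ℝ).1 hO, one_mulVec]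

/-- The isometry of Euclidean space given by an orthogonal matrix. -/
def orthogonalIsometry (O : Matrix ι ι ℝ) (hO : O ∈ orthogonalGroup ι ℝ) :
    EuclideanSpace ℝ ι ≃ₗᵢ[ℝ] EuclideanSpace ℝ ι where
  toFun x := WithLp.toLp 2 (O *ᵥ x.ofLp)
  invFun x := WithLp.toLp 2 (Oᵀ *ᵥ x.ofLp)
  map_add' x y := by ext; simp [mulVec_add]
  map_smul' r x := by ext; simp [mulVec_smul]
  left_inv x := by simp [mulVec_mulVec, (mem_orthogonalGroup_iff' ι ℝ).1 hO]
  right_inv x := by simp [mulVec_mulVec, (mem_orthogonalGroup_iff ι ℝ).1 hO]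
  norm_map' x := by
    have := dotProduct_mulVec_of_mem_orthogonalGroup hO x.ofLp x.ofLp
    simp only [dotProduct] at this
    simp [EuclideanSpace.norm_eq, pow_two, this]

/-- The measurable automorphism of `ι → ℝ` given by an orthogonal matrix. -/
def orthogonalMeasurableEquiv (O : Matrix ι ι ℝ) (hO : O ∈ orthogonalGroup ι ℝ) :
    (ι → ℝ) ≃ᵐ (ι → ℝ) where
  toFun x := O *ᵥ x
  invFun x := Oᵀ *ᵥ x
  left_inv x := by simp [mulVec_mulVec, (mem_orthogonalGroup_iff' ι ℝ).1 hO]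
  right_inv x := by simp [mulVec_mulVec, (mem_orthogonalGroup_iff ι ℝ).1 hO]
  measurable_toFun := (Continuous.matrix_mulVec continuous_const continuous_id).measurable
  measurable_invFun := (Continuous.matrix_mulVec continuous_const continuous_id).measurable

lemma exists_orthogonalGroup_mulVec_eq {x y : ι → ℝ} (h : x ⬝ᵥ x = y ⬝ᵥ y) :
    ∃ O ∈ orthogonalGroup ι ℝ, O *ᵥ x = y := by
  by_cases hxy : x = y
  · exact ⟨1, one_mem _, by simp [hxy]⟩
  set w := x - y with hw
  have hw0 : w ⬝ᵥ w ≠ 0 := fun h0 => hxy (sub_eq_zero.1 (dotProduct_self_eq_zero.1 h0))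
  have hwx : 2 * (w ⬝ᵥ x) = w ⬝ᵥ w := by
    simp only [hw, sub_dotProduct, dotProduct_sub, dotProduct_comm y x]
    linarith
  refine ⟨1 - (2 / (w ⬝ᵥ w)) • vecMulVec w w, ?_, ?_⟩
  · rw [mem_orthogonalGroup_iff]
    have ht : (vecMulVec w w)ᵀ = vecMulVec w w := by
      ext i j; simp [vecMulVec_apply, mul_comm]
    have hs : (1 - (2 / (w ⬝ᵥ w)) • vecMulVec w w)ᵀ = 1 - (2 / (w ⬝ᵥ w)) • vecMulVec w w := by
      rw [transpose_sub, transpose_smul, transpose_one, ht]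
    have hm : vecMulVec w w * vecMulVec w w = (w ⬝ᵥ w) • vecMulVec w w := by
      rw [vecMulVec_mul_vecMulVec]
      ext i j
      simp [vecMulVec_apply]
      ring
    rw [hs]
    simp only [sub_mul, mul_sub, one_mul, mul_one, Matrix.smul_mul, Matrix.mul_smul, hm, smul_smul]
    have : 2 / (w ⬝ᵥ w) * (2 / (w ⬝ᵥ w) * (w ⬝ᵥ w)) = 2 / (w ⬝ᵥ w) + 2 / (w ⬝ᵥ w) := by
      field_simp; norm_num
    rw [this, add_smul]
    abel
  · rw [sub_mulVec, one_mulVec, smul_mulVec, vecMulVec_mulVec]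
    ext i
    have : w i = x i - y i := rfl
    simp only [Pi.sub_apply, Pi.smul_apply, smul_eq_mul, MulOpposite.smul_eq_mul_unop,
      MulOpposite.unop_op]
    have h2 : 2 / (w ⬝ᵥ w) * (w i * (w ⬝ᵥ x)) = w i := by
      have h3 : w ⬝ᵥ x ≠ 0 := fun h0 => hw0 (by rw [← hwx, h0, mul_zero])
      rw [← hwx]
      field_simp
    rw [h2, this]; ring

/-- The orthogonal matrix acting on `ℝ^{p × q} ⊕ ℝᵖ ⊕ ℝ^q` by `O ⊗ Q`, `O` and `Q`. -/
lemma fromBlocks_kronecker_mem_orthogonalGroup {p q : Type*} [Fintype p] [Fintype q]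
    [DecidableEq p] [DecidableEq q] {O : Matrix p p ℝ} {Q : Matrix q q ℝ}
    (hO : O ∈ orthogonalGroup p ℝ) (hQ : Q ∈ orthogonalGroup q ℝ) :
    fromBlocks (O ⊗ₖ Q) 0 0 (fromBlocks O 0 0 Q) ∈
      orthogonalGroup ((p × q) ⊕ (p ⊕ q)) ℝ := by
  rw [mem_orthogonalGroup_iff] at *
  have h1 : (O ⊗ₖ Q)ᵀ = Oᵀ ⊗ₖ Qᵀ := by ext; simp [kroneckerMap_apply]
  rw [fromBlocks_transpose, fromBlocks_transpose, fromBlocks_multiply, fromBlocks_multiply, h1,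
    ← mul_kronecker_mul, hO, hQ]
  simp

end Rotation

namespace GaussianGibbs

variable {Ω : Type*} [MeasurableSpace Ω] {P : Measure Ω} [IsProbabilityMeasure P]
  {E : Type*} [NormedAddCommGroup E] [InnerProductSpace ℝ E] [FiniteDimensional ℝ E]
  [MeasurableSpace E] [BorelSpace E]

/-- The mean slope is invariant under a simultaneous symmetry of the Gibbs reference measure and
of the Gaussian noise. -/
lemma integral_slope_eq_of_symmetry (M M' : GaussianGibbs P E) (S : Ω ≃ᵐ Ω) (hS : P.map S = P)
    (T : E ≃ₗᵢ[ℝ] E) (hB : ∀ w, M'.B (S w) = M.B w) (hc : ∀ w, M'.c (S w) = M.c w)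
    (hφ : ∀ w, M'.φ (S w) = T (M.φ w)) (hψ : ∀ w, M'.ψ (S w) = T (M.ψ w)) (R : ℝ) :
    ∫ g, M'.slope R g ∂(ProbabilityTheory.stdGaussian E)
      = ∫ g, M.slope R g ∂(ProbabilityTheory.stdGaussian E) := by
  have hSP : MeasurePreserving S P P := ⟨S.measurable, hS⟩
  have hT : MeasurePreserving T.toHomeomorph.toMeasurableEquiv (ProbabilityTheory.stdGaussian E)
      (ProbabilityTheory.stdGaussian E) :=
    ⟨T.toHomeomorph.toMeasurableEquiv.measurable, ProbabilityTheory.stdGaussian_map T⟩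
  rw [← hT.integral_comp']
  congr 1 with g
  have hH : ∀ w, M'.H R (T g) (S w) = M.H R g w := fun w => by
    simp only [H, hB, hc, hφ, hψ, ← map_smul, ← map_add, T.inner_map_map]
  change M'.slope R (T g) = M.slope R g
  unfold slope
  rw [integral_tilted, integral_tilted, ← hSP.integral_comp' (fun w => exp (M'.H R (T g) w)),
    ← hSP.integral_comp' (fun w => (exp (M'.H R (T g) w) / _) • _)]
  simp only [hH, hc, hψ, T.inner_map_map]

end GaussianGibbs

/-- The Euclidean space of all the Gaussian noise `(Z, Z̃, Z̄)`. -/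
abbrev NoiseSpace (nu nv : ℕ) : Type :=
  EuclideanSpace ℝ ((Fin nu × Fin nv) ⊕ (Fin nu ⊕ Fin nv))

/-- The noise `(Z, Z̃, Z̄)` as a single vector. -/
def noiseVec {nu nv : ℕ} (Z : Fin nu → Fin nv → ℝ) (Zt : Fin nu → ℝ) (Zb : Fin nv → ℝ) :
    NoiseSpace nu nv :=
  WithLp.toLp 2 (Sum.elim (fun p => Z p.1 p.2) (Sum.elim Zt Zb))

instance (n : ℕ) : IsProbabilityMeasure (stdGaussian n) := by unfold stdGaussian; infer_instance

instance (p q : ℕ) : IsProbabilityMeasure (stdGaussianMat p q) := by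
  unfold stdGaussianMat; infer_instance

lemma measurePreserving_noiseVec (nu nv : ℕ) :
    MeasurePreserving (fun x : (Fin nu → Fin nv → ℝ) × (Fin nu → ℝ) × (Fin nv → ℝ) =>
        noiseVec x.1 x.2.1 x.2.2)
      ((stdGaussianMat nu nv).prod ((stdGaussian nu).prod (stdGaussian nv)))
      (ProbabilityTheory.stdGaussian (NoiseSpace nu nv)) := by
  set f : (Fin nu → Fin nv → ℝ) × (Fin nu → ℝ) × (Fin nv → ℝ) →
      ((Fin nu × Fin nv) ⊕ (Fin nu ⊕ Fin nv) → ℝ) :=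
    fun x => Sum.elim (fun p => x.1 p.1 p.2) (Sum.elim x.2.1 x.2.2) with hf
  have hfm : Measurable f := by
    refine measurable_pi_lambda _ fun i => ?_
    rcases i with p | i | j <;> simp only [hf, Sum.elim_inl, Sum.elim_inr] <;> fun_prop
  have h1 : MeasurePreserving f
      ((stdGaussianMat nu nv).prod ((stdGaussian nu).prod (stdGaussian nv)))
      (Measure.pi fun _ => ProbabilityTheory.gaussianReal 0 1) := by
    refine ⟨hfm, (Measure.pi_eq fun s hs => ?_).symm⟩
    rw [Measure.map_apply hfm (MeasurableSet.univ_pi hs)]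
    have hpre : f ⁻¹' (univ.pi s) =
        (univ.pi fun i => univ.pi fun j => s (Sum.inl (i, j))) ×ˢ
          ((univ.pi fun i => s (Sum.inr (Sum.inl i))) ×ˢ
            (univ.pi fun j => s (Sum.inr (Sum.inr j)))) := by
      ext x
      simp [hf, Set.mem_pi]
    rw [hpre, Measure.prod_prod, Measure.prod_prod]
    simp only [stdGaussianMat, stdGaussian, Measure.pi_pi]
    rw [Fintype.prod_sum_type, Fintype.prod_sum_type, Fintype.prod_prod_type]
  exact MeasurePreserving.comp ⟨(by fun_prop), ProbabilityTheory.map_pi_eq_stdGaussian⟩ h1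

lemma integral_noiseVec {nu nv : ℕ} {f : NoiseSpace nu nv → ℝ}
    (hf : Integrable f (ProbabilityTheory.stdGaussian (NoiseSpace nu nv))) :
    ∫ Z, (∫ Zt, (∫ Zb, f (noiseVec Z Zt Zb) ∂(stdGaussian nv)) ∂(stdGaussian nu))
      ∂(stdGaussianMat nu nv) = ∫ g, f g ∂(ProbabilityTheory.stdGaussian (NoiseSpace nu nv)) := by
  have hmp := measurePreserving_noiseVec nu nv
  have hf' : Integrable (fun x : (Fin nu → Fin nv → ℝ) × (Fin nu → ℝ) × (Fin nv → ℝ) =>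
      f (noiseVec x.1 x.2.1 x.2.2))
      ((stdGaussianMat nu nv).prod ((stdGaussian nu).prod (stdGaussian nv))) :=
    hmp.integrable_comp_of_integrable hf
  have h1 := integral_map (f := f) hmp.measurable.aemeasurable
    (by rw [hmp.map_eq]; exact hf.aestronglyMeasurable)
  rw [hmp.map_eq] at h1
  rw [h1, integral_prod _ hf']
  refine integral_congr_ae ?_
  filter_upwards [hf'.prod_right_ae] with Z hZ
  exact (integral_prod (fun y : (Fin nu → ℝ) × (Fin nv → ℝ) => f (noiseVec Z y.1 y.2)) hZ).symm

section Model

open Matrix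

variable {nu nv : ℕ}

lemma IsUniformSphere.ae_dotProduct_eq {n : ℕ} {r : ℝ} (hr : 0 ≤ r)
    {P : Measure (Fin n → ℝ)} (hP : IsUniformSphere n (√(r * n)) P) :
    ∀ᵐ x ∂P, x ⬝ᵥ x = r * n := by
  filter_upwards [hP.2.1] with x hx
  rw [sq_sqrt (by positivity)] at hx
  simpa only [dotProduct, pow_two] using hx

/-- The direction of the coupling to the `Z` and `Z̃` noises. -/
def signalCoupling (s₁ s₂ : ℝ) (w : (Fin nu → ℝ) × (Fin nv → ℝ)) : NoiseSpace nu nv :=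
  noiseVec (fun i j => s₁ * (w.1 i * w.2 j)) (fun i => s₂ * w.1 i) 0

/-- The direction of the coupling to the `Z̄` noise. -/
def sideCoupling (s : ℝ) (w : (Fin nu → ℝ) × (Fin nv → ℝ)) : NoiseSpace nu nv :=
  noiseVec 0 0 (fun j => s * w.2 j)

/-- The `Z̄` component of the noise. -/
def sideNoise (g : NoiseSpace nu nv) : EuclideanSpace ℝ (Fin nv) :=
  WithLp.toLp 2 fun j => g (Sum.inr (Sum.inr j))

lemma inner_noiseVec (Z : Fin nu → Fin nv → ℝ) (Zt : Fin nu → ℝ) (Zb : Fin nv → ℝ)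
    (g : NoiseSpace nu nv) :
    ⟪noiseVec Z Zt Zb, g⟫ = (∑ i, ∑ j, Z i j * g (Sum.inl (i, j)))
      + ((∑ i, Zt i * g (Sum.inr (Sum.inl i))) + ∑ j, Zb j * g (Sum.inr (Sum.inr j))) := by
  simp [noiseVec, PiLp.inner_apply, Fintype.sum_sum_type, Fintype.sum_prod_type, mul_comm]

lemma norm_sq_noiseVec (Z : Fin nu → Fin nv → ℝ) (Zt : Fin nu → ℝ) (Zb : Fin nv → ℝ) :
    ‖noiseVec Z Zt Zb‖ ^ 2 = (∑ i, ∑ j, Z i j ^ 2) + ((∑ i, Zt i ^ 2) + ∑ j, Zb j ^ 2) := by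
  rw [← real_inner_self_eq_norm_sq, inner_noiseVec]
  simp [noiseVec, pow_two]

lemma inner_noiseVec_zero_zero (x : Fin nv → ℝ) (g : NoiseSpace nu nv) :
    ⟪noiseVec (0 : Fin nu → Fin nv → ℝ) 0 x, g⟫ = ⟪WithLp.toLp 2 x, sideNoise g⟫ := by
  rw [inner_noiseVec]
  simp [sideNoise, PiLp.inner_apply, mul_comm]

lemma norm_noiseVec_zero_zero (x : Fin nv → ℝ) :
    ‖noiseVec (0 : Fin nu → Fin nv → ℝ) 0 x‖ = ‖(WithLp.toLp 2 x : EuclideanSpace ℝ (Fin nv))‖ := by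
  rw [← sq_eq_sq₀ (norm_nonneg _) (norm_nonneg _), norm_sq_noiseVec, EuclideanSpace.norm_sq_eq]
  simp

lemma continuous_noiseVec {X : Type*} [TopologicalSpace X] {Z : X → Fin nu → Fin nv → ℝ}
    {Zt : X → Fin nu → ℝ} {Zb : X → Fin nv → ℝ} (hZ : Continuous Z) (hZt : Continuous Zt)
    (hZb : Continuous Zb) : Continuous fun x => noiseVec (Z x) (Zt x) (Zb x) := by
  refine (PiLp.continuous_toLp 2 _).comp (continuous_pi fun i => ?_)
  rcases i with p | i | j <;> simp only [Sum.elim_inl, Sum.elim_inr] <;> fun_prop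

lemma continuous_sideNoise : Continuous (sideNoise : NoiseSpace nu nv → _) :=
  (PiLp.continuous_toLp 2 _).comp (by fun_prop)

lemma sideNoise_sub (x y : NoiseSpace nu nv) : sideNoise (x - y) = sideNoise x - sideNoise y := by
  ext; simp [sideNoise]

/-- The part of the exponent of the Gibbs weight that depends neither on the noise nor on the
strength of the side channel. -/
def energyBase (n : ℕ) (av t Rv : ℝ) (U : Fin nu → ℝ) (V : Fin nv → ℝ)
    (w : (Fin nu → ℝ) × (Fin nv → ℝ)) : ℝ :=
  -((1 - t) / (2 * n) * ((w.1 ⬝ᵥ w.1) * (w.2 ⬝ᵥ w.2))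
    - √((1 - t) / n) ^ 2 * ((w.1 ⬝ᵥ U) * (w.2 ⬝ᵥ V))
    + (av * Rv / 2 * (w.1 ⬝ᵥ w.1) - √(av * Rv) ^ 2 * (w.1 ⬝ᵥ U)))

/-- The coefficient of the strength of the side channel in the exponent of the Gibbs weight. -/
def energySide (au : ℝ) (V : Fin nv → ℝ) (w : (Fin nu → ℝ) × (Fin nv → ℝ)) : ℝ :=
  au * (w.2 ⬝ᵥ V - w.2 ⬝ᵥ w.2 / 2)

lemma neg_interpH_eq (n : ℕ) {au : ℝ} (hau : 0 ≤ au) (av t : ℝ) {R : ℝ} (hR : 0 ≤ R) (Rv : ℝ)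
    (U : Fin nu → ℝ) (V : Fin nv → ℝ) (Z : Fin nu → Fin nv → ℝ) (Zt : Fin nu → ℝ)
    (Zb : Fin nv → ℝ) (u : Fin nu → ℝ) (v : Fin nv → ℝ) :
    -interpH n nu nv au av t R Rv U V Z Zt Zb u v =
      energyBase n av t Rv U V (u, v) + R * energySide au V (u, v)
      + ⟪signalCoupling √((1 - t) / n) √(av * Rv) (u, v) + √R • sideCoupling √au (u, v),
        noiseVec Z Zt Zb⟫ := by
  have h1 : ∀ x y : Fin nu → ℝ, ∀ x' y' : Fin nv → ℝ,
      (x ⬝ᵥ y) * (x' ⬝ᵥ y') = ∑ i, ∑ j, x i * y i * (x' j * y' j) := fun x y x' y' => by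
    rw [dotProduct, dotProduct, Finset.sum_mul_sum]
  have hs : √(au * R) = √au * √R := sqrt_mul hau R
  have hs2 : (√au * √R) ^ 2 = au * R := by rw [mul_pow, sq_sqrt hau, sq_sqrt hR]
  have e1 : (∑ i, ∑ j, ((1 - t) / (2 * n) * (u i) ^ 2 * (v j) ^ 2
      - √((1 - t) / n) * u i * v j * (√((1 - t) / n) * U i * V j + Z i j))) =
      (1 - t) / (2 * n) * ((u ⬝ᵥ u) * (v ⬝ᵥ v)) - √((1 - t) / n) ^ 2 * ((u ⬝ᵥ U) * (v ⬝ᵥ V))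
        - ∑ i, ∑ j, √((1 - t) / n) * (u i * v j) * Z i j := by
    rw [h1, h1]
    simp only [Finset.mul_sum, ← Finset.sum_sub_distrib]
    exact Finset.sum_congr rfl fun i _ => Finset.sum_congr rfl fun j _ => by ring
  have e2 : (∑ i, (av * Rv / 2 * (u i) ^ 2 - √(av * Rv) * u i * (√(av * Rv) * U i + Zt i))) =
      av * Rv / 2 * (u ⬝ᵥ u) - √(av * Rv) ^ 2 * (u ⬝ᵥ U) - ∑ i, √(av * Rv) * u i * Zt i := by
    simp only [dotProduct, Finset.mul_sum, ← Finset.sum_sub_distrib]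
    exact Finset.sum_congr rfl fun i _ => by ring
  have e3 : (∑ j, (au * R / 2 * (v j) ^ 2 - √(au * R) * v j * (√(au * R) * V j + Zb j))) =
      au * R / 2 * (v ⬝ᵥ v) - au * R * (v ⬝ᵥ V) - √R * ∑ j, √au * v j * Zb j := by
    rw [hs]
    simp only [dotProduct, Finset.mul_sum, ← Finset.sum_sub_distrib]
    exact Finset.sum_congr rfl fun j _ => by rw [← hs2]; ring
  unfold energyBase energySide interpH
  rw [e1, e2, e3, inner_add_left, real_inner_smul_left, signalCoupling, sideCoupling,
    inner_noiseVec, inner_noiseVec]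
  simp only [noiseVec, Sum.elim_inl, Sum.elim_inr, Pi.zero_apply, zero_mul,
    Finset.sum_const_zero, add_zero, zero_add]
  ring

lemma calL_eq (n : ℕ) {au : ℝ} (hau : 0 ≤ au) (R : ℝ) (u : Fin nu → ℝ)
    (v V : Fin nv → ℝ) (Z : Fin nu → Fin nv → ℝ) (Zt : Fin nu → ℝ) (Zb : Fin nv → ℝ) :
    calL n nv au R v V Zb = 1 / n * -(energySide au V (u, v)
      + ⟪sideCoupling √au (u, v), noiseVec Z Zt Zb⟫ / (2 * √R)) := by
  have hs : √(au / R) = √au / √R := sqrt_div hau R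
  unfold calL energySide
  rw [sideCoupling, inner_noiseVec, hs]
  simp only [noiseVec, Sum.elim_inr, Pi.zero_apply, zero_mul, Finset.sum_const_zero, zero_add]
  congr 1
  simp only [dotProduct, Finset.sum_div, Finset.mul_sum, ← Finset.sum_sub_distrib,
    ← Finset.sum_add_distrib, ← Finset.sum_neg_distrib]
  exact Finset.sum_congr rfl fun j _ => by ring

lemma continuous_energyBase (n : ℕ) (av t Rv : ℝ) (U : Fin nu → ℝ) (V : Fin nv → ℝ) :
    Continuous (energyBase n av t Rv U V) := by
  unfold energyBase dotProduct; fun_prop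

lemma continuous_energySide (au : ℝ) (V : Fin nv → ℝ) :
    Continuous (energySide au V : (Fin nu → ℝ) × (Fin nv → ℝ) → ℝ) := by
  unfold energySide dotProduct; fun_prop

lemma continuous_signalCoupling (s₁ s₂ : ℝ) :
    Continuous (signalCoupling s₁ s₂ : (Fin nu → ℝ) × (Fin nv → ℝ) → NoiseSpace nu nv) :=
  continuous_noiseVec (by fun_prop) (by fun_prop) (by fun_prop)

lemma continuous_sideCoupling (s : ℝ) :
    Continuous (sideCoupling s : (Fin nu → ℝ) × (Fin nv → ℝ) → NoiseSpace nu nv) :=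
  continuous_noiseVec (by fun_prop) (by fun_prop) (by fun_prop)

lemma norm_sq_signalCoupling (s₁ s₂ : ℝ) (w : (Fin nu → ℝ) × (Fin nv → ℝ)) :
    ‖signalCoupling s₁ s₂ w‖ ^ 2 =
      s₁ ^ 2 * ((w.1 ⬝ᵥ w.1) * (w.2 ⬝ᵥ w.2)) + s₂ ^ 2 * (w.1 ⬝ᵥ w.1) := by
  rw [signalCoupling, norm_sq_noiseVec, dotProduct, dotProduct, Finset.sum_mul_sum]
  simp only [Finset.mul_sum, Pi.zero_apply, zero_mul, Finset.sum_const_zero, add_zero, pow_two,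
    mul_mul_mul_comm]

lemma norm_sq_sideCoupling (s : ℝ) (w : (Fin nu → ℝ) × (Fin nv → ℝ)) :
    ‖sideCoupling s w‖ ^ 2 = s ^ 2 * (w.2 ⬝ᵥ w.2) := by
  rw [sideCoupling, norm_sq_noiseVec]
  simp [Finset.mul_sum, dotProduct, pow_two, mul_mul_mul_comm]

lemma abs_energySide_le {au : ℝ} (hau : 0 ≤ au) (V : Fin nv → ℝ)
    (w : (Fin nu → ℝ) × (Fin nv → ℝ)) :
    |energySide au V w| ≤ au * (w.2 ⬝ᵥ w.2 + V ⬝ᵥ V / 2) := by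
  have h0 : ∀ z : Fin nv → ℝ, 0 ≤ z ⬝ᵥ z := fun z => Finset.sum_nonneg fun i _ =>
    mul_self_nonneg _
  have h1 := h0 (w.2 - V)
  have h2 := h0 (w.2 + V)
  have h3 := h0 w.2
  have h4 := h0 V
  simp only [sub_dotProduct, dotProduct_sub, add_dotProduct, dotProduct_add,
    dotProduct_comm V w.2] at h1 h2
  unfold energySide
  rw [abs_mul, abs_of_nonneg hau]
  refine mul_le_mul_of_nonneg_left (abs_le.2 ⟨?_, ?_⟩) hau <;> linarith

/-- A continuous function on a product of Euclidean spaces is essentially bounded with respect to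
a product of measures on spheres. -/
lemma memLp_top_of_continuous {Pu : Measure (Fin nu → ℝ)} {Pv : Measure (Fin nv → ℝ)}
    [IsProbabilityMeasure Pu] [IsProbabilityMeasure Pv] {x y : ℝ}
    (hPu : ∀ᵐ u ∂Pu, u ⬝ᵥ u = x) (hPv : ∀ᵐ v ∂Pv, v ⬝ᵥ v = y)
    {f : (Fin nu → ℝ) × (Fin nv → ℝ) → ℝ} (hf : Continuous f) : MemLp f ⊤ (Pu.prod Pv) := by
  obtain ⟨C, hC⟩ := (((isCompact_closedBall (0 : Fin nu → ℝ) √x).prod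
    (isCompact_closedBall (0 : Fin nv → ℝ) √y)).exists_bound_of_continuousOn hf.continuousOn)
  have hsup : ∀ (k : ℕ) (z : Fin k → ℝ), z ∈ Metric.closedBall 0 √(z ⬝ᵥ z) := fun k z => by
    rw [mem_closedBall_zero_iff, pi_norm_le_iff_of_nonneg (sqrt_nonneg _)]
    intro i
    refine abs_le_sqrt ?_
    rw [pow_two]
    exact Finset.single_le_sum (f := fun i => z i * z i) (fun i _ => mul_self_nonneg _)
      (Finset.mem_univ i)
  refine memLp_top_of_bound hf.aestronglyMeasurable C ?_
  filter_upwards [Measure.quasiMeasurePreserving_fst.ae hPu,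
    Measure.quasiMeasurePreserving_snd.ae hPv] with w h1 h2
  exact hC w ⟨h1 ▸ hsup _ w.1, h2 ▸ hsup _ w.2⟩

/-- The Gibbs model of the interpolating Hamiltonian with planted signal `(U, V)`. -/
def interpModel (n : ℕ) {au : ℝ} (hau : 0 ≤ au) (av t Rv : ℝ) {ru rv : ℝ} (hru : 0 ≤ ru)
    (hrv : 0 ≤ rv) {Pu : Measure (Fin nu → ℝ)} {Pv : Measure (Fin nv → ℝ)}
    (hPu : IsUniformSphere nu √(ru * nu) Pu) (hPv : IsUniformSphere nv √(rv * nv) Pv)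
    (U : Fin nu → ℝ) (V : Fin nv → ℝ) : GaussianGibbs (Pu.prod Pv) (NoiseSpace nu nv) where
  B := energyBase n av t Rv U V
  c := energySide au V
  φ := signalCoupling √((1 - t) / n) √(av * Rv)
  ψ := sideCoupling √au
  κ g := √au * √(rv * nv) * ‖sideNoise g‖
  q g := noiseVec 0 0 ((√au * √(rv * nv) * ‖sideNoise g‖⁻¹) • (sideNoise g).ofLp)
  Cc := au * (rv * nv + V ⬝ᵥ V / 2)
  Lφ := √(√((1 - t) / n) ^ 2 * ((ru * nu) * (rv * nv)) + √(av * Rv) ^ 2 * (ru * nu))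
  Lψ := √au * √(rv * nv)
  measurable_B := (continuous_energyBase n av t Rv U V).measurable
  measurable_c := (continuous_energySide au V).measurable
  measurable_φ := (continuous_signalCoupling _ _).measurable
  measurable_ψ := (continuous_sideCoupling _).measurable
  measurable_κ := (continuous_const.mul continuous_sideNoise.norm).measurable
  measurable_q := by
    have h : Continuous fun p : ℝ × NoiseSpace nu nv =>
        (noiseVec 0 0 (p.1 • (sideNoise p.2).ofLp) : NoiseSpace nu nv) :=
      continuous_noiseVec continuous_const continuous_const
        (continuous_fst.smul ((PiLp.continuous_ofLp 2 _).comp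
          (continuous_sideNoise.comp continuous_snd)))
    exact h.measurable.comp (((continuous_sideNoise.norm.measurable.inv).const_mul _).prodMk
      measurable_id)
  memLp_B := by
    have := hPu.1
    have := hPv.1
    exact memLp_top_of_continuous (hPu.ae_dotProduct_eq hru) (hPv.ae_dotProduct_eq hrv)
      (continuous_energyBase n av t Rv U V)
  abs_c_le := by
    have := hPu.1
    have := hPv.1
    filter_upwards [Measure.quasiMeasurePreserving_snd.ae (hPv.ae_dotProduct_eq hrv)] with w h
    rw [← h]
    exact abs_energySide_le hau V w
  norm_φ_le := by
    have := hPu.1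
    have := hPv.1
    filter_upwards [Measure.quasiMeasurePreserving_fst.ae (hPu.ae_dotProduct_eq hru),
      Measure.quasiMeasurePreserving_snd.ae (hPv.ae_dotProduct_eq hrv)] with w h1 h2
    rw [← h1, ← h2, ← norm_sq_signalCoupling, sqrt_sq (norm_nonneg _)]
  norm_ψ_le := by
    have := hPu.1
    have := hPv.1
    filter_upwards [Measure.quasiMeasurePreserving_snd.ae (hPv.ae_dotProduct_eq hrv)] with w h
    rw [← h, ← sqrt_mul hau, ← sq_sqrt hau, ← norm_sq_sideCoupling, sq_sqrt hau,
      sqrt_sq (norm_nonneg _)]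
  norm_q_le g := by
    rw [norm_noiseVec_zero_zero, WithLp.toLp_smul, WithLp.toLp_ofLp, norm_smul, norm_mul, norm_inv,
      norm_norm, norm_of_nonneg (show 0 ≤ √au * √(rv * nv) by positivity), mul_assoc]
    exact mul_le_of_le_one_right (by positivity) (inv_mul_le_one)
  subgradient x y := by
    have hK : 0 ≤ √au * √(rv * nv) := by positivity
    rw [inner_noiseVec_zero_zero, WithLp.toLp_smul, WithLp.toLp_ofLp, real_inner_smul_left,
      sideNoise_sub, inner_sub_right, real_inner_self_eq_norm_sq]
    have h := real_inner_le_norm (sideNoise x) (sideNoise y)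
    rcases (norm_nonneg (sideNoise x)).eq_or_lt with h0 | h0
    · rw [← h0]
      simp only [_root_.inv_zero, mul_zero, zero_mul, add_zero]
      positivity
    · have h1 : ‖sideNoise x‖⁻¹ * (⟪sideNoise x, sideNoise y⟫ - ‖sideNoise x‖ ^ 2)
          ≤ ‖sideNoise y‖ - ‖sideNoise x‖ := by
        rw [inv_mul_le_iff₀ h0]; linarith [h, mul_sub ‖sideNoise x‖ ‖sideNoise y‖ ‖sideNoise x‖]
      have h2 := mul_le_mul_of_nonneg_left h1 hK
      rw [← mul_assoc] at h2
      linarith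
  abs_inner_le g := by
    have := hPu.1
    have := hPv.1
    filter_upwards [Measure.quasiMeasurePreserving_snd.ae (hPv.ae_dotProduct_eq hrv)] with w h
    rw [sideCoupling, inner_noiseVec_zero_zero]
    refine (abs_real_inner_le_norm _ _).trans (mul_le_mul_of_nonneg_right ?_ (norm_nonneg _))
    rw [← norm_noiseVec_zero_zero (nu := nu), ← sideCoupling, ← h, ← sqrt_mul hau]
    refine le_sqrt_of_sq_le ?_
    rw [norm_sq_sideCoupling, sq_sqrt hau]

end Model

lemma integral_le_of_ae_le_const {Ω : Type*} [MeasurableSpace Ω] {μ : Measure Ω}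
    [IsProbabilityMeasure μ] {f : Ω → ℝ} {C : ℝ} (hC : 0 ≤ C) (hf : ∀ᵐ x ∂μ, f x ≤ C) :
    ∫ x, f x ∂μ ≤ C := by
  by_cases h : Integrable f μ
  · simpa using integral_mono_ae h (integrable_const C) hf
  · rwa [integral_undef h]

section Model

open Matrix

variable {nu nv n : ℕ} {au : ℝ} (hau : 0 ≤ au) {av t Rv : ℝ} {ru rv : ℝ} (hru : 0 ≤ ru)
    (hrv : 0 ≤ rv) {Pu : Measure (Fin nu → ℝ)} {Pv : Measure (Fin nv → ℝ)}
    (hPu : IsUniformSphere nu √(ru * nu) Pu) (hPv : IsUniformSphere nv √(rv * nv) Pv)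

lemma gibbs_calL_eq_slope {R : ℝ} (hR : 0 < R) (U : Fin nu → ℝ) (V : Fin nv → ℝ)
    (Z : Fin nu → Fin nv → ℝ) (Zt : Fin nu → ℝ) (Zb : Fin nv → ℝ) :
    gibbs n nu nv au av t R Rv Pu Pv U V Z Zt Zb (fun _ v => calL n nv au R v V Zb)
      = 1 / n * (interpModel n hau av t Rv hru hrv hPu hPv U V).slope R (noiseVec Z Zt Zb) := by
  have := hPu.1
  have := hPv.1
  set M := interpModel n hau av t Rv hru hrv hPu hPv U V with hM
  set g := noiseVec Z Zt Zb with hg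
  have hH : ∀ u v, -interpH n nu nv au av t R Rv U V Z Zt Zb u v = M.H R g (u, v) := fun u v =>
    neg_interpH_eq n hau av t hR.le Rv U V Z Zt Zb u v
  have hL : ∀ u v, calL n nv au R v V Zb
      = 1 / n * -(M.c (u, v) + ⟪M.ψ (u, v), g⟫ / (2 * √R)) := fun u v =>
    calL_eq n hau R u v V Z Zt Zb
  have hexp := memLp_top_exp (M.memLp_H R g)
  have hX : MemLp (fun w => 1 / (n : ℝ) * -(M.c w + (2 * √R)⁻¹ * ⟪M.ψ w, g⟫)) ⊤ (Pu.prod Pv) :=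
    ((M.memLp_c.add ((M.memLp_ψ.inner_const g).const_mul _)).neg).const_mul _
  simp_rw [inv_mul_eq_div] at hX
  have hXI : Integrable (fun w => 1 / (n : ℝ) * -(M.c w + ⟪M.ψ w, g⟫ / (2 * √R))
      * exp (M.H R g w)) (Pu.prod Pv) :=
    (hexp.mul' (r := ⊤) hX).integrable le_top
  have hnum : (∫ u, (∫ v, calL n nv au R v V Zb
      * exp (-(interpH n nu nv au av t R Rv U V Z Zt Zb u v)) ∂Pv) ∂Pu) =
      ∫ w, 1 / (n : ℝ) * -(M.c w + ⟪M.ψ w, g⟫ / (2 * √R)) * exp (M.H R g w) ∂(Pu.prod Pv) := by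
    rw [integral_prod _ hXI]
    refine integral_congr_ae (Eventually.of_forall fun u => ?_)
    refine integral_congr_ae (Eventually.of_forall fun v => ?_)
    beta_reduce
    rw [hH, hL u v]
  have hden : partFun n nu nv au av t R Rv Pu Pv U V Z Zt Zb
      = ∫ w, exp (M.H R g w) ∂(Pu.prod Pv) := by
    rw [integral_prod _ (hexp.integrable le_top), partFun]
    simp only [hH]
  rw [gibbs, hnum, hden, GaussianGibbs.slope, integral_tilted, ← integral_neg,
    ← integral_const_mul, ← integral_div]
  refine integral_congr_ae (Eventually.of_forall fun w => ?_)
  simp only [smul_eq_mul]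
  ring

lemma integral_slope_interpModel_eq {U U' : Fin nu → ℝ} {V V' : Fin nv → ℝ}
    (hU : U ⬝ᵥ U = U' ⬝ᵥ U') (hV : V ⬝ᵥ V = V' ⬝ᵥ V') (R : ℝ) :
    ∫ g, (interpModel n hau av t Rv hru hrv hPu hPv U' V').slope R g
        ∂(ProbabilityTheory.stdGaussian (NoiseSpace nu nv)) =
      ∫ g, (interpModel n hau av t Rv hru hrv hPu hPv U V).slope R g
        ∂(ProbabilityTheory.stdGaussian (NoiseSpace nu nv)) := by
  have := hPu.1
  have := hPv.1
  obtain ⟨O, hO, rfl⟩ := exists_orthogonalGroup_mulVec_eq hU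
  obtain ⟨Q, hQ, rfl⟩ := exists_orthogonalGroup_mulVec_eq hV
  have hnoise : ∀ (x : Fin nu → ℝ) (y : Fin nv → ℝ) (s : ℝ) (x' : Fin nu → ℝ) (y' : Fin nv → ℝ),
      orthogonalIsometry _ (fromBlocks_kronecker_mem_orthogonalGroup hO hQ)
        (noiseVec (fun i j => s * (x i * y j)) x' y') =
      noiseVec (fun i j => s * ((O *ᵥ x) i * (Q *ᵥ y) j)) (O *ᵥ x') (Q *ᵥ y') := by
    intro x y s x' y'
    change WithLp.toLp 2 (_ *ᵥ Sum.elim _ (Sum.elim _ _)) = WithLp.toLp 2 _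
    rw [fromBlocks_mulVec]
    simp only [Sum.elim_comp_inl, Sum.elim_comp_inr, fromBlocks_mulVec, zero_mulVec, add_zero,
      zero_add]
    congr 2
    ext ⟨i, j⟩
    simp only [mulVec, dotProduct, kroneckerMap_apply, Fintype.sum_prod_type]
    rw [Finset.sum_mul_sum]
    simp only [Finset.mul_sum]
    exact Finset.sum_congr rfl fun k _ => Finset.sum_congr rfl fun l _ => by ring
  refine GaussianGibbs.integral_slope_eq_of_symmetry _ _
    ((orthogonalMeasurableEquiv O hO).prodCongr (orthogonalMeasurableEquiv Q hQ)) ?_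
    (orthogonalIsometry _ (fromBlocks_kronecker_mem_orthogonalGroup hO hQ)) ?_ ?_ ?_ ?_ R
  · change (Pu.prod Pv).map (Prod.map (fun x => O *ᵥ x) (fun x => Q *ᵥ x)) = _
    have hOm : Measurable fun x => O *ᵥ x := (orthogonalMeasurableEquiv O hO).measurable
    have hQm : Measurable fun x => Q *ᵥ x := (orthogonalMeasurableEquiv Q hQ).measurable
    rw [← Measure.map_prod_map _ _ hOm hQm, hPu.2.2 O hO, hPv.2.2 Q hQ]
  · intro w
    change energyBase n av t Rv (O *ᵥ U) (Q *ᵥ V) (O *ᵥ w.1, Q *ᵥ w.2) = energyBase n av t Rv U V w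
    simp only [energyBase, dotProduct_mulVec_of_mem_orthogonalGroup hO,
      dotProduct_mulVec_of_mem_orthogonalGroup hQ]
  · intro w
    change energySide au (Q *ᵥ V) (O *ᵥ w.1, Q *ᵥ w.2) = energySide au V w
    simp only [energySide, dotProduct_mulVec_of_mem_orthogonalGroup hQ]
  · intro w
    have h := hnoise w.1 w.2 √((1 - t) / n) (√(av * Rv) • w.1) 0
    simp only [mulVec_zero, mulVec_smul] at h
    exact h.symm
  · intro w
    have h := hnoise 0 0 0 0 (√au • w.2)
    simp only [zero_mul, mulVec_zero, mulVec_smul] at h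
    exact h.symm

lemma eL_eq {R : ℝ} (hR : 0 < R) {U₀ : Fin nu → ℝ} {V₀ : Fin nv → ℝ}
    (hU₀ : U₀ ⬝ᵥ U₀ = ru * nu) (hV₀ : V₀ ⬝ᵥ V₀ = rv * nv) :
    eL n nu nv au av t R Rv Pu Pv = 1 / n * ∫ g,
      (interpModel n hau av t Rv hru hrv hPu hPv U₀ V₀).slope R g
        ∂(ProbabilityTheory.stdGaussian (NoiseSpace nu nv)) := by
  have := hPu.1
  have := hPv.1
  unfold eL Efull
  simp_rw [gibbs_calL_eq_slope hau hru hrv hPu hPv hR]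
  have key : ∀ᵐ U ∂Pu, (∫ V, (∫ Z, (∫ Zt, (∫ Zb,
      1 / (n : ℝ) * (interpModel n hau av t Rv hru hrv hPu hPv U V).slope R (noiseVec Z Zt Zb)
      ∂(stdGaussian nv)) ∂(stdGaussian nu)) ∂(stdGaussianMat nu nv)) ∂Pv) = 1 / n * ∫ g,
      (interpModel n hau av t Rv hru hrv hPu hPv U₀ V₀).slope R g
        ∂(ProbabilityTheory.stdGaussian (NoiseSpace nu nv)) := by
    filter_upwards [hPu.ae_dotProduct_eq hru] with U hU
    have h : ∀ᵐ V ∂Pv, (∫ Z, (∫ Zt, (∫ Zb,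
        1 / (n : ℝ) * (interpModel n hau av t Rv hru hrv hPu hPv U V).slope R (noiseVec Z Zt Zb)
        ∂(stdGaussian nv)) ∂(stdGaussian nu)) ∂(stdGaussianMat nu nv)) = 1 / n * ∫ g,
        (interpModel n hau av t Rv hru hrv hPu hPv U₀ V₀).slope R g
          ∂(ProbabilityTheory.stdGaussian (NoiseSpace nu nv)) := by
      filter_upwards [hPv.ae_dotProduct_eq hrv] with V hV
      rw [integral_slope_interpModel_eq hau hru hrv hPu hPv (hU.trans hU₀.symm)
        (hV.trans hV₀.symm), ← integral_const_mul]
      exact integral_noiseVec (f := fun g => 1 / (n : ℝ) *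
          (interpModel n hau av t Rv hru hrv hPu hPv U V).slope R g)
        ((((interpModel n hau av t Rv hru hrv hPu hPv U V).memLp_slope R).integrable
          (by norm_num)).const_mul _)
    rw [integral_congr_ae h]
    simp
  rw [integral_congr_ae key]
  simp

lemma quenchedVarL_le {R δ T : ℝ} (hδ : 0 < δ) (hδR : δ < R) (hRT : R + δ ≤ T)
    {U₀ : Fin nu → ℝ} {V₀ : Fin nv → ℝ}
    (hU₀ : U₀ ⬝ᵥ U₀ = ru * nu) (hV₀ : V₀ ⬝ᵥ V₀ = rv * nv)
    {M : GaussianGibbs (Pu.prod Pv) (NoiseSpace nu nv)}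
    (hM : M = interpModel n hau av t Rv hru hrv hPu hPv U₀ V₀) :
    quenchedVarL n nu nv au av t R Rv Pu Pv ≤
      (1 / n : ℝ) ^ 2 * (24 * (20 * M.Lφ ^ 2 + 30 * T * M.Lψ ^ 2) / δ ^ 2 + 5 * M.Lψ ^ 2 / 2 / R
        + 8 * (M.meanD (R - δ) - M.meanD (R + δ)) ^ 2) := by
  have := hPu.1
  have := hPv.1
  have hR : 0 < R := hδ.trans hδR
  have hT : 0 < T := by linarith
  unfold quenchedVarL Efull
  simp_rw [gibbs_calL_eq_slope hau hru hrv hPu hPv hR]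
  rw [eL_eq hau hru hrv hPu hPv hR hU₀ hV₀]
  refine integral_le_of_ae_le_const (by positivity) ?_
  filter_upwards [hPu.ae_dotProduct_eq hru] with U hU
  refine integral_le_of_ae_le_const (by positivity) ?_
  filter_upwards [hPv.ae_dotProduct_eq hrv] with V hV
  set M' := interpModel n hau av t Rv hru hrv hPu hPv U V with hM'
  have hmean : ∀ r, ∫ g, (interpModel n hau av t Rv hru hrv hPu hPv U₀ V₀).slope r g
        ∂(ProbabilityTheory.stdGaussian (NoiseSpace nu nv)) = ∫ g, M'.slope r g
        ∂(ProbabilityTheory.stdGaussian (NoiseSpace nu nv)) :=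
    integral_slope_interpModel_eq hau hru hrv hPu hPv (hU.trans hU₀.symm) (hV.trans hV₀.symm)
  have hD : ∀ r, M'.meanD r = M.meanD r := by
    intro r
    have hκ : ∀ N : GaussianGibbs (Pu.prod Pv) (NoiseSpace nu nv), N.meanD r =
        ∫ g, N.slope r g ∂(ProbabilityTheory.stdGaussian (NoiseSpace nu nv)) +
        ∫ g, 1 / (2 * √r) * N.κ g ∂(ProbabilityTheory.stdGaussian (NoiseSpace nu nv)) := fun N =>
      integral_add ((N.memLp_slope r).integrable (by norm_num))
        ((N.memLp_κ.integrable (by norm_num)).const_mul _)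
    rw [hκ, hκ, hM, hmean]
    rfl
  have hvar := M'.variance_slope_le hδ hδR hRT
  rw [hD, hD] at hvar
  have hInt : Integrable (fun g => (1 / (n : ℝ) * M'.slope R g - 1 / n * ∫ g, M'.slope R g
      ∂(ProbabilityTheory.stdGaussian (NoiseSpace nu nv))) ^ 2)
      (ProbabilityTheory.stdGaussian (NoiseSpace nu nv)) :=
    (((M'.memLp_slope R).const_mul _).sub (memLp_const _)).integrable_sq
  rw [hmean, integral_noiseVec hInt, ← integral_const_mul, integral_const_mul_sub_integral_sq]
  refine mul_le_mul_of_nonneg_left (hvar.trans_eq ?_) (sq_nonneg _)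
  rw [hM]
  rfl

end Model

lemma integrated_bound_le {n c₁ c₂ c₃ c₄ a b δ K S : ℝ} (hn0 : 0 < n) (hc₁ : 0 ≤ c₁)
    (hc₂ : 0 ≤ c₂) (hδ : 0 < δ) (hδa : δ < a) (hab : a ≤ b) (ha1 : a < 1) (hbK : b ≤ K)
    (hsq : S ^ 2 ≤ 2 * (c₃ ^ 2 + c₄ ^ 2) / (a - δ)) :
    24 * (20 * c₁ + 60 * K * c₂) / (δ ^ 2 * n) * (b - a) + 5 * c₂ / 2 / n * log (b / a)
        + 64 * δ * S ^ 2 ≤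
      ((24 * (20 * c₁ + 60 * K * c₂) + 5 * c₂ / 2) * K + 5 * c₂ / 2 + 128 * (c₃ ^ 2 + c₄ ^ 2))
        * (1 / (δ ^ 2 * n) - log a / n + δ / (a - δ)) := by
  have ha : 0 < a := hδ.trans hδa
  have hb : 0 < b := ha.trans_le hab
  have hK : 0 < K := hb.trans_le hbK
  have had : 0 < a - δ := sub_pos.2 hδa
  have hnx : 1 / n ≤ 1 / (δ ^ 2 * n) := by
    refine one_div_le_one_div_of_le (by positivity) (mul_le_of_le_one_left hn0.le ?_)
    exact pow_le_one₀ hδ.le (hδa.trans ha1).le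
  have hlog : 0 ≤ -(log a / n) := by
    rw [← neg_div]; exact div_nonneg (neg_nonneg.2 (log_nonpos ha.le ha1.le)) hn0.le
  have hy : 0 < δ / (a - δ) := div_pos hδ had
  have hlogb : log b ≤ K := by linarith [log_le_sub_one_of_pos hb]
  have t1 : 24 * (20 * c₁ + 60 * K * c₂) / (δ ^ 2 * n) * (b - a)
      ≤ 24 * (20 * c₁ + 60 * K * c₂) * K * (1 / (δ ^ 2 * n)) := by
    have : 24 * (20 * c₁ + 60 * K * c₂) / (δ ^ 2 * n) * (b - a)
        ≤ 24 * (20 * c₁ + 60 * K * c₂) / (δ ^ 2 * n) * K :=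
      mul_le_mul_of_nonneg_left (by linarith) (by positivity)
    exact this.trans_eq (by ring)
  have t2 : 5 * c₂ / 2 / n * log (b / a)
      ≤ 5 * c₂ / 2 * K * (1 / (δ ^ 2 * n)) + 5 * c₂ / 2 * (-(log a / n)) := by
    have e1 : 5 * c₂ / 2 / n * log (b / a)
        = 5 * c₂ / 2 * (1 / n) * log b + 5 * c₂ / 2 * (-(log a / n)) := by
      rw [log_div hb.ne' ha.ne']; ring
    rw [e1]
    gcongr ?_ + _
    calc 5 * c₂ / 2 * (1 / n) * log b ≤ 5 * c₂ / 2 * (1 / n) * K := by gcongr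
      _ = 5 * c₂ / 2 * K * (1 / n) := by ring
      _ ≤ _ := by gcongr
  have t3 : 64 * δ * S ^ 2 ≤ 128 * (c₃ ^ 2 + c₄ ^ 2) * (δ / (a - δ)) :=
    (mul_le_mul_of_nonneg_left hsq (by positivity)).trans_eq (by ring)
  have e : 1 / (δ ^ 2 * n) - log a / n + δ / (a - δ)
      = 1 / (δ ^ 2 * n) + -(log a / n) + δ / (a - δ) := by ring
  rw [e]
  refine (add_le_add (add_le_add t1 t2) t3).trans ?_
  have hx : 0 < 1 / (δ ^ 2 * n) := by positivity
  generalize 1 / (δ ^ 2 * n) = x at *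
  generalize -(log a / n) = z at *
  generalize δ / (a - δ) = y at *
  have p1 : 0 ≤ 24 * (20 * c₁ + 60 * K * c₂) * K := by positivity
  have p2 : 0 ≤ 5 * c₂ / 2 := by positivity
  have p4 : 0 ≤ 128 * (c₃ ^ 2 + c₄ ^ 2) := by positivity
  have p3 : 0 ≤ 5 * c₂ / 2 * K := by positivity
  linear_combination mul_nonneg p1 hlog + mul_nonneg p1 hy.le + mul_nonneg p3 hlog
    + mul_nonneg p3 hy.le + mul_nonneg p2 hx.le + mul_nonneg p2 hy.le
    + mul_nonneg p4 hx.le + mul_nonneg p4 hlog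

section Model

open Matrix

variable {nu nv n : ℕ} {au : ℝ} (hau : 0 ≤ au) {av t Rv : ℝ} {ru rv : ℝ} (hru : 0 ≤ ru)
    (hrv : 0 ≤ rv) {Pu : Measure (Fin nu → ℝ)} {Pv : Measure (Fin nv → ℝ)}
    (hPu : IsUniformSphere nu √(ru * nu) Pu) (hPv : IsUniformSphere nv √(rv * nv) Pv)

lemma integral_norm_sq_sideNoise :
    Integrable (fun g : NoiseSpace nu nv => ‖sideNoise g‖ ^ 2)
      (ProbabilityTheory.stdGaussian (NoiseSpace nu nv)) ∧
    ∫ g : NoiseSpace nu nv, ‖sideNoise g‖ ^ 2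
      ∂(ProbabilityTheory.stdGaussian (NoiseSpace nu nv)) = nv := by
  have h : ∀ g : NoiseSpace nu nv, ‖sideNoise g‖ ^ 2 =
      ∑ j, ⟪EuclideanSpace.single (Sum.inr (Sum.inr j)) (1 : ℝ), g⟫ ^ 2 := fun g => by
    simp [EuclideanSpace.norm_sq_eq, sideNoise, EuclideanSpace.inner_single_left]
  have hI : ∀ j : Fin nv, Integrable (fun g : NoiseSpace nu nv =>
      ⟪EuclideanSpace.single (Sum.inr (Sum.inr j)) (1 : ℝ), g⟫ ^ 2)
      (ProbabilityTheory.stdGaussian (NoiseSpace nu nv)) := fun j =>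
    Integrable.of_integral_ne_zero (by rw [integral_inner_sq_stdGaussian]; simp)
  simp only [h]
  refine ⟨integrable_finsetSum _ fun j _ => hI j, ?_⟩
  rw [integral_finsetSum _ fun j _ => hI j]
  simp [integral_inner_sq_stdGaussian]

lemma integral_κ_interpModel_le (U : Fin nu → ℝ) (V : Fin nv → ℝ) :
    ∫ g, (interpModel n hau av t Rv hru hrv hPu hPv U V).κ g
      ∂(ProbabilityTheory.stdGaussian (NoiseSpace nu nv)) ≤ (au * rv + 1) / 2 * nv := by
  have := hPu.1
  have := hPv.1
  obtain ⟨hI, hval⟩ := integral_norm_sq_sideNoise (nu := nu) (nv := nv)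
  have hK : (√au * √(rv * nv)) ^ 2 = au * (rv * nv) := by
    rw [mul_pow, sq_sqrt hau, sq_sqrt (by positivity)]
  have hI' : Integrable (fun g : NoiseSpace nu nv => au * (rv * nv) / 2 + 1 / 2 * ‖sideNoise g‖ ^ 2)
      (ProbabilityTheory.stdGaussian (NoiseSpace nu nv)) :=
    (integrable_const _).add (hI.const_mul _)
  have hκ := (interpModel n hau av t Rv hru hrv hPu hPv U V).memLp_κ.integrable (by norm_num)
  refine (integral_mono hκ hI' fun g => ?_).trans_eq ?_
  · change √au * √(rv * nv) * ‖sideNoise g‖ ≤ au * (rv * nv) / 2 + 1 / 2 * ‖sideNoise g‖ ^ 2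
    nlinarith [sq_nonneg (√au * √(rv * nv) - ‖sideNoise g‖)]
  · rw [integral_add (integrable_const _) (hI.const_mul _), integral_const_mul, hval]
    simp only [integral_const, probReal_univ, one_smul]
    ring

lemma integral_quenchedVarL_le (hn : 1 ≤ n) {U₀ : Fin nu → ℝ} {V₀ : Fin nv → ℝ}
    (hU₀ : U₀ ⬝ᵥ U₀ = ru * nu) (hV₀ : V₀ ⬝ᵥ V₀ = rv * nv)
    {M : GaussianGibbs (Pu.prod Pv) (NoiseSpace nu nv)}
    (hM : M = interpModel n hau av t Rv hru hrv hPu hPv U₀ V₀) {c₁ c₂ c₃ c₄ : ℝ}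
    (h₁ : M.Lφ ^ 2 ≤ c₁ * n) (h₂ : M.Lψ ^ 2 ≤ c₂ * n) (h₃ : M.Cc ≤ c₃ * n)
    (h₄ : ∫ g, M.κ g ∂(ProbabilityTheory.stdGaussian (NoiseSpace nu nv)) ≤ c₄ * n)
    {a b δ K : ℝ} (hδ : 0 < δ) (hδa : δ < a) (hab : a ≤ b) (ha1 : a < 1) (hbK : b ≤ K) :
    ∫ R in a..b, quenchedVarL n nu nv au av t R Rv Pu Pv ≤
      ((24 * (20 * c₁ + 60 * K * c₂) + 5 * c₂ / 2) * K + 5 * c₂ / 2 + 128 * (c₃ ^ 2 + c₄ ^ 2))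
        * (1 / (δ ^ 2 * n) - log a / n + δ / (a - δ)) := by
  have := hPu.1
  have := hPv.1
  have hn0 : (0 : ℝ) < n := by exact_mod_cast hn
  have ha : 0 < a := hδ.trans hδa
  have hb : 0 < b := ha.trans_le hab
  have hK : 0 < K := hb.trans_le hbK
  have had : 0 < a - δ := sub_pos.2 hδa
  have hc₁ : 0 ≤ c₁ := nonneg_of_mul_nonneg_left ((sq_nonneg _).trans h₁) hn0
  have hc₂ : 0 ≤ c₂ := nonneg_of_mul_nonneg_left ((sq_nonneg _).trans h₂) hn0
  have hκ0 : 0 ≤ ∫ g, M.κ g ∂(ProbabilityTheory.stdGaussian (NoiseSpace nu nv)) :=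
    integral_nonneg M.κ_nonneg
  have hc₄ : 0 ≤ c₄ := nonneg_of_mul_nonneg_left (hκ0.trans h₄) hn0
  set S := c₃ + c₄ / √(a - δ) with hS
  have hanti : AntitoneOn (fun R => 1 / (n : ℝ) * M.meanD R) (Ioi 0) := fun x hx y hy hxy =>
    mul_le_mul_of_nonneg_left (M.antitoneOn_meanD hx hy hxy) (by positivity)
  have hbound : ∀ R ∈ Icc (a - δ) (b + δ), |1 / (n : ℝ) * M.meanD R| ≤ S := by
    intro R hR
    have hR0 : 0 < R := had.trans_le hR.1
    rw [abs_mul, abs_of_pos (by positivity), one_div, inv_mul_le_iff₀ hn0]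
    refine (M.abs_meanD_le hR0).trans ?_
    have hs : √(a - δ) ≤ √R := sqrt_le_sqrt hR.1
    have hs0 := sqrt_pos.2 had
    have : (∫ g, M.κ g ∂(ProbabilityTheory.stdGaussian (NoiseSpace nu nv))) / √R
        ≤ c₄ * n / √(a - δ) := by gcongr
    rw [hS, mul_add]
    refine add_le_add (h₃.trans_eq (mul_comm _ _)) (this.trans_eq ?_)
    ring
  have hsq : S ^ 2 ≤ 2 * (c₃ ^ 2 + c₄ ^ 2) / (a - δ) := by
    have hs : √(a - δ) ^ 2 = a - δ := sq_sqrt had.le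
    have h5 : (c₄ / √(a - δ)) ^ 2 = c₄ ^ 2 / (a - δ) := by rw [div_pow, hs]
    have h6 : c₃ ^ 2 ≤ c₃ ^ 2 / (a - δ) := by
      rw [le_div_iff₀ had]; nlinarith [sq_nonneg c₃]
    have h7 : 2 * (c₃ ^ 2 + c₄ ^ 2) / (a - δ) = 2 * (c₃ ^ 2 / (a - δ)) + 2 * (c₄ ^ 2 / (a - δ)) := by
      ring
    rw [h7, ← h5]
    nlinarith [sq_nonneg (c₃ - c₄ / √(a - δ))]
  have hq : ∀ R ∈ Icc a b, quenchedVarL n nu nv au av t R Rv Pu Pv ≤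
      24 * (20 * c₁ + 60 * K * c₂) / (δ ^ 2 * n) + 5 * c₂ / 2 / n / R
      + 8 * (1 / (n : ℝ) * M.meanD (R - δ) - 1 / n * M.meanD (R + δ)) ^ 2 := by
    intro R hR
    have hR0 : 0 < R := ha.trans_le hR.1
    refine (quenchedVarL_le hau hru hrv hPu hPv hδ (hδa.trans_le hR.1) (T := 2 * K)
      (by linarith [hR.2]) hU₀ hV₀ hM).trans ?_
    have e1 : 24 * (20 * M.Lφ ^ 2 + 30 * (2 * K) * M.Lψ ^ 2) / δ ^ 2
        ≤ 24 * (20 * (c₁ * n) + 30 * (2 * K) * (c₂ * n)) / δ ^ 2 := by gcongr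
    have e2 : 5 * M.Lψ ^ 2 / 2 / R ≤ 5 * (c₂ * n) / 2 / R := by gcongr
    have e3 := mul_le_mul_of_nonneg_left (add_le_add e1 e2) (sq_nonneg (1 / (n : ℝ)))
    have e4 : (1 / (n : ℝ)) ^ 2 * (24 * (20 * (c₁ * n) + 30 * (2 * K) * (c₂ * n)) / δ ^ 2
        + 5 * (c₂ * n) / 2 / R) =
        24 * (20 * c₁ + 60 * K * c₂) / (δ ^ 2 * n) + 5 * c₂ / 2 / n / R := by
      field_simp
      ring
    rw [e4] at e3
    have e5 : (1 / (n : ℝ)) ^ 2 * (8 * (M.meanD (R - δ) - M.meanD (R + δ)) ^ 2) =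
        8 * (1 / (n : ℝ) * M.meanD (R - δ) - 1 / n * M.meanD (R + δ)) ^ 2 := by ring
    rw [mul_add, e5]
    linarith
  refine (integral_le_of_supergradient_bound hanti (by positivity) (by positivity) hδ hδa hab
    hbound hq).trans (integrated_bound_le hn0 hc₁ hc₂ hδ hδa hab ha1 hbK hsq)

end Model

/-- **Proposition: quenched fluctuations of `𝓛`.** Let `M_u, M_v > 0`.
For `n` large enough, there exists a constant `M` such that for all
`(a,b) ∈ (0,M_u)²` with `a < min{1,b}`, all `δ ∈ (0,a)`, all `R_v ∈ [0,M_v]` and all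
`t ∈ [0,1]`:
`∫_a^b E[(⟨𝓛⟩ − E⟨𝓛⟩)²] dR_u ≤ M(1/(δ²n) − ln(a)/n + δ/(a−δ))`. -/
theorem quenched_fluctuations_calL
    (au av ru rv : ℝ) (hau : 0 < au) (hav : 0 < av) (hru : 0 < ru) (hrv : 0 < rv)
    (nuf nvf : ℕ → ℕ)
    (hnuf : Tendsto (fun n => (nuf n : ℝ) / n) atTop (nhds au))
    (hnvf : Tendsto (fun n => (nvf n : ℝ) / n) atTop (nhds av))
    (Pu : (n : ℕ) → Measure (Fin (nuf n) → ℝ))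
    (Pv : (n : ℕ) → Measure (Fin (nvf n) → ℝ))
    (hPu : ∀ n, IsUniformSphere (nuf n) (Real.sqrt (ru * nuf n)) (Pu n))
    (hPv : ∀ n, IsUniformSphere (nvf n) (Real.sqrt (rv * nvf n)) (Pv n))
    (Mu Mv : ℝ) (hMu : 0 < Mu) (hMv : 0 < Mv) :
    ∃ (N : ℕ) (M : ℝ), ∀ n : ℕ, N ≤ n →
      ∀ a b : ℝ, a ∈ Ioo (0:ℝ) Mu → b ∈ Ioo (0:ℝ) Mu → a < min 1 b →
        ∀ δ : ℝ, δ ∈ Ioo (0:ℝ) a → ∀ Rv ∈ Icc (0:ℝ) Mv, ∀ t ∈ Icc (0:ℝ) 1,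
          (∫ Ru in a..b, quenchedVarL n (nuf n) (nvf n) au av t Ru Rv (Pu n) (Pv n))
            ≤ M * (1 / (δ ^ 2 * n) - Real.log a / n + δ / (a - δ)) := by
  obtain ⟨N₁, hN₁⟩ := eventually_atTop.1 (hnuf.eventually (gt_mem_nhds (lt_add_one au)))
  obtain ⟨N₂, hN₂⟩ := eventually_atTop.1 (hnvf.eventually (gt_mem_nhds (lt_add_one av)))
  set c₁ := ru * (au + 1) * (rv * (av + 1)) + av * Mv * (ru * (au + 1)) with hc₁
  set c₂ := au * rv * (av + 1) with hc₂
  set c₃ := 3 / 2 * (au * rv * (av + 1)) with hc₃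
  set c₄ := (au * rv + 1) / 2 * (av + 1) with hc₄
  refine ⟨max 1 (max N₁ N₂), (24 * (20 * c₁ + 60 * Mu * c₂) + 5 * c₂ / 2) * Mu + 5 * c₂ / 2
    + 128 * (c₃ ^ 2 + c₄ ^ 2), fun n hn a b ha hb hab δ hδ Rv hRv t ht => ?_⟩
  have hn1 : 1 ≤ n := (le_max_left _ _).trans hn
  have hn0 : (0 : ℝ) < n := by exact_mod_cast hn1
  have hnu : (nuf n : ℝ) ≤ (au + 1) * n := (div_le_iff₀ hn0).1
    (hN₁ n ((le_max_left _ _).trans ((le_max_right _ _).trans hn))).le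
  have hnv : (nvf n : ℝ) ≤ (av + 1) * n := (div_le_iff₀ hn0).1
    (hN₂ n ((le_max_right _ _).trans ((le_max_right _ _).trans hn))).le
  have := (hPu n).1
  have := (hPv n).1
  obtain ⟨U₀, hU₀⟩ := ((hPu n).ae_dotProduct_eq hru.le).exists
  obtain ⟨V₀, hV₀⟩ := ((hPv n).ae_dotProduct_eq hrv.le).exists
  refine integral_quenchedVarL_le hau.le hru.le hrv.le (hPu n) (hPv n) hn1 hU₀ hV₀ rfl
    ?_ ?_ ?_ ?_ hδ.1 hδ.2 (hab.trans_le (min_le_right _ _)).le (hab.trans_le (min_le_left _ _))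
    hb.2.le
  · change √(√((1 - t) / n) ^ 2 * ((ru * nuf n) * (rv * nvf n))
      + √(av * Rv) ^ 2 * (ru * nuf n)) ^ 2 ≤ _
    rw [sq_sqrt (by positivity), sq_sqrt (div_nonneg (sub_nonneg.2 ht.2) hn0.le),
      sq_sqrt (mul_nonneg hav.le hRv.1)]
    have e1 : (1 - t) / n ≤ 1 / n := by gcongr; linarith [ht.1]
    calc (1 - t) / n * ((ru * nuf n) * (rv * nvf n)) + av * Rv * (ru * nuf n)
        ≤ 1 / n * ((ru * ((au + 1) * n)) * (rv * ((av + 1) * n)))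
          + av * Mv * (ru * ((au + 1) * n)) := by
          gcongr
          exact hRv.2
      _ = c₁ * n := by rw [hc₁]; field_simp
  · change (√au * √(rv * nvf n)) ^ 2 ≤ _
    rw [mul_pow, sq_sqrt hau.le, sq_sqrt (by positivity)]
    calc au * (rv * nvf n) ≤ au * (rv * ((av + 1) * n)) := by gcongr
      _ = c₂ * n := by rw [hc₂]; ring
  · change au * (rv * nvf n + dotProduct V₀ V₀ / 2) ≤ _
    rw [hV₀]
    calc au * (rv * nvf n + rv * nvf n / 2)
        ≤ au * (rv * ((av + 1) * n) + rv * ((av + 1) * n) / 2) := by gcongr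
      _ = c₃ * n := by rw [hc₃]; ring
  · refine (integral_κ_interpModel_le hau.le hru.le hrv.le (hPu n) (hPv n) U₀ V₀).trans ?_
    calc (au * rv + 1) / 2 * (nvf n : ℝ) ≤ (au * rv + 1) / 2 * ((av + 1) * n) := by gcongr
      _ = c₄ * n := by rw [hc₄]; ring

end
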